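/- arXiv:1208.3777 — 9 statements merged into one kernel-verified Lean document; each statement's English description precedes it below -/
import Mathlib

section
/- Let c < d be real numbers, let a > 0, let q : [c,d] → ℝ be continuous, and let f₁, f₂, f₃, f₄ : ℂ → ℂ be entire functions. Then there exists a function U : [c,d] × ℂ → ℂ such that for every λ ∈ ℂ the function x ↦ U(x,λ) is four times continuously differentiable on [c,d], satisfies a⁴·∂ₓ⁴U(x,λ) + q(x)·U(x,λ) = λ·U(x,λ) for all x ∈ [c,d] together with ∂ₓᵏU(c,λ) = f_{k+1}(λ) for k = 0,1,2,3, and such that for every fixed x ∈ [c,d] the function λ ↦ U(x,λ) is entire (analytic on all of ℂ). -/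
open Set

section Resolvent

variable {E : Type*} [NormedAddCommGroup E] [NormedSpace ℂ E] [CompleteSpace E]

theorem ContinuousLinearMap.isUnit_one_sub_of_norm_pow_lt_one {T : E →L[ℂ] E} {n : ℕ}
    (hT : ‖T ^ n‖ < 1) : IsUnit (1 - T) := by
  have hunit := isUnit_one_sub_of_norm_lt_one hT
  rw [← mul_neg_geom_sum] at hunit
  exact ((Commute.sum_right _ _ _ fun i _ =>
    ((Commute.one_left _).sub_left (Commute.refl _)).pow_right i).isUnit_mul_iff.1 hunit).1

theorem exists_differentiable_eq_add_apply {T : ℂ → E →L[ℂ] E} {p : ℂ → E}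
    (hT : Differentiable ℂ T) (hp : Differentiable ℂ p) (hunit : ∀ z, IsUnit (1 - T z)) :
    ∃ u : ℂ → E, Differentiable ℂ u ∧ ∀ z, u z = p z + T z (u z) := by
  refine ⟨fun z => Ring.inverse (1 - T z) (p z), fun z =>
    ((differentiableAt_inverse (hunit z)).comp z ((hT z).const_sub 1)).clm_apply (hp z),
    fun z => ?_⟩
  exact sub_eq_iff_eq_add.1 (congrArg (fun S => S (p z)) (Ring.mul_inverse_cancel _ (hunit z)))

end Resolvent

section Volterra

open Filter Topology

variable {c d : ℝ} (h : c ≤ d)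

/-- The antiderivative vanishing at `c` of a continuous function on `[c,d]`. -/
noncomputable def volterra : C(Icc c d, ℂ) →L[ℂ] C(Icc c d, ℂ) :=
  LinearMap.mkContinuous
    { toFun := fun f =>
        ⟨fun x => ∫ t in c..(x : ℝ), IccExtend h f t,
          (intervalIntegral.continuous_primitive
            (fun _ _ => f.continuous.Icc_extend'.intervalIntegrable _ _) c).comp
            continuous_subtype_val⟩
      map_add' := fun f g => by
        ext x
        exact intervalIntegral.integral_add
          (f.continuous.Icc_extend'.intervalIntegrable _ _)
          (g.continuous.Icc_extend'.intervalIntegrable _ _)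
      map_smul' := fun r f => by
        ext x
        exact intervalIntegral.integral_smul r (IccExtend h f) }
    (d - c) fun f => by
      refine (ContinuousMap.norm_le _ (by have := sub_nonneg.2 h; positivity)).2 fun x => ?_
      have hb := intervalIntegral.norm_integral_le_of_norm_le_const (a := c) (b := x)
        (f := IccExtend h f) (C := ‖f‖) fun t _ => f.norm_coe_le_norm _
      rw [abs_of_nonneg (sub_nonneg.2 x.2.1)] at hb
      refine hb.trans ?_
      rw [mul_comm]
      gcongr
      exact x.2.2

theorem volterra_apply (f : C(Icc c d, ℂ)) (x : Icc c d) :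
    volterra h f x = ∫ t in c..(x : ℝ), IccExtend h f t := rfl

theorem norm_volterra_apply_le {f : C(Icc c d, ℂ)} {C : ℝ} {m : ℕ}
    (hf : ∀ x, ‖f x‖ ≤ C * (((x : ℝ) - c) ^ m / m.factorial)) (x : Icc c d) :
    ‖volterra h f x‖ ≤ C * (((x : ℝ) - c) ^ (m + 1) / (m + 1).factorial) := by
  rw [volterra_apply]
  have hint : ∫ t in c..(x : ℝ), C * ((t - c) ^ m / m.factorial)
      = C * (((x : ℝ) - c) ^ (m + 1) / (m + 1).factorial) := by
    rw [intervalIntegral.integral_const_mul, intervalIntegral.integral_div,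
      intervalIntegral.integral_comp_sub_right (fun t => t ^ m), integral_pow, Nat.factorial_succ]
    push_cast
    field_simp
    simp
  rw [← hint]
  refine intervalIntegral.norm_integral_le_of_norm_le x.2.1 ?_
    (Continuous.intervalIntegrable (by fun_prop) _ _)
  refine Eventually.of_forall fun t ht => ?_
  have htI : t ∈ Icc c d := ⟨ht.1.le, ht.2.trans x.2.2⟩
  rw [IccExtend_of_mem h f htI]
  exact hf ⟨t, htI⟩

/-- The operator sending `u` to the fourfold antiderivative of `g * u`. -/
noncomputable def volterraFour (g : C(Icc c d, ℂ)) : C(Icc c d, ℂ) →L[ℂ] C(Icc c d, ℂ) :=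
  (volterra h ^ 4).comp (ContinuousLinearMap.mul ℂ C(Icc c d, ℂ) g)

theorem volterraFour_apply (g u : C(Icc c d, ℂ)) :
    volterraFour h g u = volterra h (volterra h (volterra h (volterra h (g * u)))) := rfl

theorem norm_volterraFour_pow_apply_le (g u : C(Icc c d, ℂ)) (n : ℕ) (x : Icc c d) :
    ‖(volterraFour h g ^ n) u x‖
      ≤ (‖g‖ ^ n * ‖u‖) * (((x : ℝ) - c) ^ (4 * n) / (4 * n).factorial) := by
  induction n generalizing x with
  | zero => simpa using u.norm_coe_le_norm x
  | succ n ih =>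
    rw [pow_succ', mul_apply_eq_comp, volterraFour_apply]
    refine norm_volterra_apply_le h (m := 4 * n + 3) (norm_volterra_apply_le h
      (norm_volterra_apply_le h (norm_volterra_apply_le h fun y => ?_))) x
    rw [ContinuousMap.mul_apply, norm_mul, pow_succ', mul_assoc, mul_assoc, ← mul_assoc (‖g‖ ^ n)]
    exact mul_le_mul (g.norm_coe_le_norm y) (ih y) (norm_nonneg _) (norm_nonneg _)

theorem norm_volterraFour_pow_le (g : C(Icc c d, ℂ)) (n : ℕ) :
    ‖volterraFour h g ^ n‖
      ≤ ((max 1 ‖g‖) * (d - c)) ^ (4 * n) / (4 * n).factorial := by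
  have hdc : 0 ≤ d - c := sub_nonneg.2 h
  refine ContinuousLinearMap.opNorm_le_bound _ (by positivity) fun u => ?_
  refine (ContinuousMap.norm_le _ (by positivity)).2 fun x => ?_
  refine (norm_volterraFour_pow_apply_le h g u n x).trans ?_
  have hx : (x : ℝ) - c ≤ d - c := by linarith [x.2.2]
  have hx0 : 0 ≤ (x : ℝ) - c := sub_nonneg.2 x.2.1
  have hg : ‖g‖ ^ n ≤ (max 1 ‖g‖) ^ (4 * n) :=
    (pow_le_pow_left₀ (norm_nonneg _) (le_max_right _ _) n).trans
      (pow_le_pow_right₀ (le_max_left _ _) (by lia))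
  calc (‖g‖ ^ n * ‖u‖) * (((x : ℝ) - c) ^ (4 * n) / (4 * n).factorial)
      ≤ ((max 1 ‖g‖) ^ (4 * n) * ‖u‖) * ((d - c) ^ (4 * n) / (4 * n).factorial) := by gcongr
    _ = _ := by rw [mul_pow]; ring

theorem isUnit_one_sub_volterraFour (g : C(Icc c d, ℂ)) : IsUnit (1 - volterraFour h g) := by
  have hlim : Tendsto (fun n : ℕ =>
      ((max 1 ‖g‖) * (d - c)) ^ (4 * n) / ((4 * n).factorial : ℝ)) atTop (𝓝 0) :=
    (FloorSemiring.tendsto_pow_div_factorial_atTop ((max 1 ‖g‖) * (d - c))).comp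
      (tendsto_id.const_mul_atTop' (by norm_num : 0 < 4))
  obtain ⟨n, hn⟩ := (hlim.eventually_lt_const one_pos).exists
  exact ContinuousLinearMap.isUnit_one_sub_of_norm_pow_lt_one ((norm_volterraFour_pow_le h g n).trans_lt hn)

theorem Differentiable.volterraFour {g : ℂ → C(Icc c d, ℂ)} (hg : Differentiable ℂ g) :
    Differentiable ℂ fun z => volterraFour h (g z) :=
  (differentiable_const _).clm_comp
    ((ContinuousLinearMap.mul ℂ C(Icc c d, ℂ)).differentiable.comp hg)

end Volterra

/-- The antiderivative of `w` with value `z` at `c`. -/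
noncomputable def primitiveFrom (c : ℝ) (z : ℂ) (w : ℝ → ℂ) (x : ℝ) : ℂ :=
  z + ∫ t in c..x, w t

section PrimitiveFrom

variable {c : ℝ} {z : ℂ} {w : ℝ → ℂ}

theorem primitiveFrom_self : primitiveFrom c z w c = z := by simp [primitiveFrom]

theorem deriv_primitiveFrom (hw : Continuous w) : deriv (primitiveFrom c z w) = w := by
  funext x
  exact ((hw.integral_hasStrictDerivAt c x).hasDerivAt.const_add z).deriv

theorem ContDiff.primitiveFrom {n : ℕ} (hw : ContDiff ℝ n w) :
    ContDiff ℝ (n + 1 : ℕ) (primitiveFrom c z w) := by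
  push_cast
  refine contDiff_succ_iff_deriv.2 ⟨fun x =>
    ((hw.continuous.integral_hasStrictDerivAt c x).hasDerivAt.const_add z).differentiableAt,
    by simp, ?_⟩
  rwa [deriv_primitiveFrom hw.continuous]

end PrimitiveFrom

theorem primitiveFrom_IccExtend {c d : ℝ} (h : c ≤ d) (z : ℂ) (f : C(Icc c d, ℂ)) {w : ℝ → ℂ}
    (hw : ∀ x : Icc c d, w x = f x) (x : Icc c d) :
    primitiveFrom c z w x = (algebraMap ℂ C(Icc c d, ℂ) z + volterra h f) x := by
  rw [ContinuousMap.add_apply, volterra_apply, primitiveFrom]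
  congr 1
  refine intervalIntegral.integral_congr fun t ht => ?_
  rw [uIcc_of_le x.2.1] at ht
  have htI : t ∈ Icc c d := ⟨ht.1, ht.2.trans x.2.2⟩
  simpa [IccExtend_of_mem h f htI] using hw ⟨t, htI⟩

/-- For the fourth order equation `a^4 u'''' + q u = λ u` on `[c,d]` with initial
data at `c` given by entire functions `f1, f2, f3, f4` of the spectral parameter `λ`,
there is a solution `U(x,λ)` which, for each fixed `x ∈ [c,d]`, is an entire
function of `λ`. -/
theorem fourth_order_solution_entire_in_lambda
    (c d a : ℝ) (hcd : c < d) (ha : 0 < a) (q : ℝ → ℝ)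
    (hq : ContinuousOn q (Icc c d))
    (f1 f2 f3 f4 : ℂ → ℂ)
    (hf1 : Differentiable ℂ f1) (hf2 : Differentiable ℂ f2)
    (hf3 : Differentiable ℂ f3) (hf4 : Differentiable ℂ f4) :
    ∃ U : ℝ → ℂ → ℂ,
      (∀ lam : ℂ,
        ContDiffOn ℝ 4 (fun x => U x lam) (Icc c d) ∧
        (∀ x ∈ Icc c d,
          (a : ℂ) ^ 4 * iteratedDerivWithin 4 (fun x => U x lam) (Icc c d) x
            + (q x : ℂ) * U x lam = lam * U x lam) ∧
        U c lam = f1 lam ∧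
        iteratedDerivWithin 1 (fun x => U x lam) (Icc c d) c = f2 lam ∧
        iteratedDerivWithin 2 (fun x => U x lam) (Icc c d) c = f3 lam ∧
        iteratedDerivWithin 3 (fun x => U x lam) (Icc c d) c = f4 lam) ∧
      ∀ x ∈ Icc c d, Differentiable ℂ (fun lam => U x lam) := by
  have h := hcd.le
  let V := volterra h
  let Q : C(Icc c d, ℂ) := ⟨fun x => (q x : ℂ),
    Complex.continuous_ofReal.comp (continuousOn_iff_continuous_domRestrict.1 hq)⟩
  let g : ℂ → C(Icc c d, ℂ) := fun lam => ((a : ℂ) ^ 4)⁻¹ • (lam • 1 - Q)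
  let P : ℂ → C(Icc c d, ℂ) := fun lam =>
    f1 lam • 1 + f2 lam • V 1 + f3 lam • V (V 1) + f4 lam • V (V (V 1))
  have hg : Differentiable ℂ g := by fun_prop
  have hP : Differentiable ℂ P := by fun_prop
  obtain ⟨u, hud, hu⟩ := exists_differentiable_eq_add_apply (hg.volterraFour h) hP
    fun lam => isUnit_one_sub_volterraFour h (g lam)
  let w0 : ℂ → ℝ → ℂ := fun lam => IccExtend h (g lam * u lam)
  let w1 : ℂ → ℝ → ℂ := fun lam => primitiveFrom c (f4 lam) (w0 lam)
  let w2 : ℂ → ℝ → ℂ := fun lam => primitiveFrom c (f3 lam) (w1 lam)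
  let w3 : ℂ → ℝ → ℂ := fun lam => primitiveFrom c (f2 lam) (w2 lam)
  let w4 : ℂ → ℝ → ℂ := fun lam => primitiveFrom c (f1 lam) (w3 lam)
  have hw4 : ∀ lam (x : Icc c d), w4 lam x = u lam x := fun lam x => by
    have h0 : ∀ x : Icc c d, w0 lam x = (g lam * u lam) x := fun x =>
      IccExtend_val h _ x
    have := primitiveFrom_IccExtend h (f1 lam) _ (primitiveFrom_IccExtend h (f2 lam) _
      (primitiveFrom_IccExtend h (f3 lam) _ (primitiveFrom_IccExtend h (f4 lam) _ h0))) x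
    refine this.trans (congrArg (fun v : C(Icc c d, ℂ) => v x) ?_)
    refine Eq.trans ?_ (hu lam).symm
    rw [volterraFour_apply]
    simp only [Algebra.algebraMap_eq_smul_one, map_add, map_smul, P, V]
    abel
  have hc0 : ∀ lam, ContDiff ℝ (0 : ℕ) (w0 lam) := fun lam =>
    contDiff_zero.2 (g lam * u lam).continuous.Icc_extend'
  have hc1 : ∀ lam, ContDiff ℝ (1 : ℕ) (w1 lam) := fun lam => (hc0 lam).primitiveFrom
  have hc2 : ∀ lam, ContDiff ℝ (2 : ℕ) (w2 lam) := fun lam => (hc1 lam).primitiveFrom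
  have hc3 : ∀ lam, ContDiff ℝ (3 : ℕ) (w3 lam) := fun lam => (hc2 lam).primitiveFrom
  have hc4 : ∀ lam, ContDiff ℝ (4 : ℕ) (w4 lam) := fun lam => (hc3 lam).primitiveFrom
  have hd1 : ∀ lam, iteratedDeriv 1 (w4 lam) = w3 lam := fun lam => by
    rw [iteratedDeriv_one, deriv_primitiveFrom (hc3 lam).continuous]
  have hd2 : ∀ lam, iteratedDeriv 2 (w4 lam) = w2 lam := fun lam => by
    rw [iteratedDeriv_succ, hd1, deriv_primitiveFrom (hc2 lam).continuous]
  have hd3 : ∀ lam, iteratedDeriv 3 (w4 lam) = w1 lam := fun lam => by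
    rw [iteratedDeriv_succ, hd2, deriv_primitiveFrom (hc1 lam).continuous]
  have hd4 : ∀ lam, iteratedDeriv 4 (w4 lam) = w0 lam := fun lam => by
    rw [iteratedDeriv_succ, hd3, deriv_primitiveFrom (hc0 lam).continuous]
  have hwithin : ∀ lam (k : ℕ), k ≤ 4 → ∀ x ∈ Icc c d,
      iteratedDerivWithin k (w4 lam) (Icc c d) x = iteratedDeriv k (w4 lam) x :=
    fun lam k hk x hx => iteratedDerivWithin_eq_iteratedDeriv (uniqueDiffOn_Icc hcd)
      ((hc4 lam).of_le (by exact_mod_cast hk)).contDiffAt hx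
  have hcmem : c ∈ Icc c d := left_mem_Icc.2 h
  refine ⟨fun x lam => w4 lam x, fun lam => ⟨(hc4 lam).contDiffOn, fun x hx => ?_,
    primitiveFrom_self, ?_, ?_, ?_⟩, fun x hx => ?_⟩
  · have ha' : (a : ℂ) ≠ 0 := by exact_mod_cast ha.ne'
    have hx0 : w0 lam x = ((a : ℂ) ^ 4)⁻¹ * (lam - q x) * u lam ⟨x, hx⟩ := by
      simp [w0, IccExtend_of_mem h _ hx, g, Q, mul_assoc]
    have hx4 : w4 lam x = u lam ⟨x, hx⟩ := hw4 lam ⟨x, hx⟩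
    beta_reduce
    rw [hwithin lam 4 le_rfl x hx, hd4, hx0, hx4]
    field_simp
    ring
  · rw [hwithin lam 1 (by norm_num) c hcmem, hd1]
    exact primitiveFrom_self
  · rw [hwithin lam 2 (by norm_num) c hcmem, hd2]
    exact primitiveFrom_self
  · rw [hwithin lam 3 (by norm_num) c hcmem, hd3]
    exact primitiveFrom_self
  · have heval : (fun lam => w4 lam x)
        = fun lam => ContinuousMap.evalCLM ℂ (⟨x, hx⟩ : Icc c d) (u lam) :=
      funext fun lam => hw4 lam ⟨x, hx⟩
    rw [heval]
    exact (ContinuousMap.evalCLM ℂ (⟨x, hx⟩ : Icc c d)).differentiable.comp hud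
end

section
/- λ ∈ ℂ is an eigenvalue of the boundary value problem (P) if and only if W(λ) = 0. -/
open Set

/-- `u` solves the fourth order equation `a^4 u'''' + q u = λ u` on `S` and is
four times continuously differentiable there. -/
def SolvesODE (a : ℝ) (q : ℝ → ℝ) (lam : ℂ) (S : Set ℝ) (u : ℝ → ℂ) : Prop :=
  ContDiffOn ℝ 4 u S ∧
  ∀ x ∈ S, (a : ℂ) ^ 4 * iteratedDerivWithin 4 u S x + (q x : ℂ) * u x = lam * u x

/-- `λ` is an eigenvalue of the discontinuous boundary value problem (P). -/
def IsEigenvalue (a1 a2 β1 β2 δ1 δ2 : ℝ) (q : ℝ → ℝ) (lam : ℂ) : Prop :=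
  ∃ u1 u2 : ℝ → ℂ,
    SolvesODE a1 q lam (Icc (-1 : ℝ) 0) u1 ∧
    SolvesODE a2 q lam (Icc (0 : ℝ) 1) u2 ∧
    ¬ (EqOn u1 0 (Icc (-1 : ℝ) 0) ∧ EqOn u2 0 (Icc (0 : ℝ) 1)) ∧
    u1 (-1) = 0 ∧
    (β1 : ℂ) * iteratedDerivWithin 1 u1 (Icc (-1 : ℝ) 0) (-1)
      + (β2 : ℂ) * iteratedDerivWithin 2 u1 (Icc (-1 : ℝ) 0) (-1) = 0 ∧
    u2 0 = u1 0 ∧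
    iteratedDerivWithin 1 u2 (Icc (0 : ℝ) 1) 0 = iteratedDerivWithin 1 u1 (Icc (-1 : ℝ) 0) 0 ∧
    iteratedDerivWithin 2 u2 (Icc (0 : ℝ) 1) 0 - iteratedDerivWithin 2 u1 (Icc (-1 : ℝ) 0) 0
      + lam * (δ1 : ℂ) * iteratedDerivWithin 1 u1 (Icc (-1 : ℝ) 0) 0 = 0 ∧
    iteratedDerivWithin 3 u2 (Icc (0 : ℝ) 1) 0 - iteratedDerivWithin 3 u1 (Icc (-1 : ℝ) 0) 0
      + lam * (δ2 : ℂ) * u1 0 = 0 ∧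
    lam * u2 1 + iteratedDerivWithin 3 u2 (Icc (0 : ℝ) 1) 1 = 0 ∧
    lam * iteratedDerivWithin 1 u2 (Icc (0 : ℝ) 1) 1
      + iteratedDerivWithin 2 u2 (Icc (0 : ℝ) 1) 1 = 0

open scoped NNReal

namespace SolvesODE

variable {a s t : ℝ} {q : ℝ → ℝ} {lam : ℂ} {ι : Type*} [Fintype ι]

theorem hasDerivWithinAt_iteratedDerivWithin {u : ℝ → ℂ} (hst : s < t)
    (hu : SolvesODE a q lam (Icc s t) u) {n : ℕ} (hn : n < 4) {x : ℝ} (hx : x ∈ Icc s t) :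
    HasDerivWithinAt (iteratedDerivWithin n u (Icc s t))
      (iteratedDerivWithin (n + 1) u (Icc s t) x) (Icc s t) x := by
  rw [iteratedDerivWithin_succ]
  exact (hu.1.differentiableOn_iteratedDerivWithin (by exact_mod_cast hn)
    (uniqueDiffOn_Icc hst) x hx).hasDerivWithinAt

theorem iteratedDerivWithin_linearCombination {u : ι → ℝ → ℂ} (hst : s < t)
    (hu : ∀ j, SolvesODE a q lam (Icc s t) (u j)) (c : ι → ℂ) {n : ℕ} (hn : n ≤ 4)
    {x : ℝ} (hx : x ∈ Icc s t) :
    iteratedDerivWithin n (fun y => ∑ j, c j * u j y) (Icc s t) x =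
      ∑ j, c j * iteratedDerivWithin n (u j) (Icc s t) x := by
  have hcd : ∀ j, ContDiffWithinAt ℝ n (u j) (Icc s t) x := fun j =>
    ((hu j).1 x hx).of_le (by exact_mod_cast hn)
  rw [iteratedDerivWithin_fun_sum hx (uniqueDiffOn_Icc hst)
    fun j _ => contDiffWithinAt_const.mul (hcd j)]
  exact Finset.sum_congr rfl fun j _ =>
    iteratedDerivWithin_const_mul hx (uniqueDiffOn_Icc hst) (c j) (hcd j)

theorem linearCombination {u : ι → ℝ → ℂ} (hst : s < t)
    (hu : ∀ j, SolvesODE a q lam (Icc s t) (u j)) (c : ι → ℂ) :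
    SolvesODE a q lam (Icc s t) (fun y => ∑ j, c j * u j y) := by
  refine ⟨ContDiffOn.sum fun j _ => contDiffOn_const.mul (hu j).1, fun x hx => ?_⟩
  rw [iteratedDerivWithin_linearCombination hst hu c le_rfl hx]
  simp only [Finset.mul_sum, ← Finset.sum_add_distrib]
  refine Finset.sum_congr rfl fun j _ => ?_
  linear_combination c j * (hu j).2 x hx

/-- The vector field of the first order system equivalent to `u'''' = g u`. -/
def companionField (g : ℂ) (y : Fin 4 → ℂ) : Fin 4 → ℂ :=
  ![y 1, y 2, y 3, g * y 0]

theorem lipschitzWith_companionField {K : ℝ≥0} (hK : 1 ≤ K) {g : ℂ} (hg : ‖g‖ ≤ K) :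
    LipschitzWith K (companionField g) := by
  refine LipschitzWith.of_dist_le_mul fun y z => ?_
  have hle : dist y z ≤ K * dist y z := le_mul_of_one_le_left dist_nonneg (by exact_mod_cast hK)
  refine (dist_pi_le_iff (by positivity)).2 fun i => ?_
  fin_cases i
  · exact (dist_le_pi_dist y z 1).trans hle
  · exact (dist_le_pi_dist y z 2).trans hle
  · exact (dist_le_pi_dist y z 3).trans hle
  · change dist (g * y 0) (g * z 0) ≤ _
    rw [dist_eq_norm, ← mul_sub, norm_mul, ← dist_eq_norm]
    exact mul_le_mul hg (dist_le_pi_dist y z 0) dist_nonneg K.2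

/-- A solution whose Cauchy data vanish at one point of the interval is zero. -/
theorem eqOn_zero {u : ℝ → ℂ} (hst : s < t) (ha : a ≠ 0) (hq : ContinuousOn q (Icc s t))
    (hu : SolvesODE a q lam (Icc s t) u) {x : ℝ} (hx : x ∈ Icc s t)
    (h0 : ∀ n < 4, iteratedDerivWithin n u (Icc s t) x = 0) : EqOn u 0 (Icc s t) := by
  have ha4 : (a : ℂ) ≠ 0 := by exact_mod_cast ha
  let g : ℝ → ℂ := fun y => (lam - q y) / (a : ℂ) ^ 4
  have hgc : ContinuousOn g (Icc s t) :=
    (continuousOn_const.sub (Complex.continuous_ofReal.comp_continuousOn hq)).div_const _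
  obtain ⟨C, hC⟩ := isCompact_Icc.exists_bound_of_continuousOn hgc
  let K : ℝ≥0 := max 1 C.toNNReal
  have hlip : ∀ y ∈ Icc s t, LipschitzOnWith K (companionField (g y)) univ := fun y hy =>
    (lipschitzWith_companionField (le_max_left _ _) ((hC y hy).trans
      ((Real.le_coe_toNNReal C).trans (by exact_mod_cast le_max_right _ _)))).lipschitzOnWith
  let v : ℝ → Fin 4 → ℂ := fun y i => iteratedDerivWithin i u (Icc s t) y
  have hv : ∀ y ∈ Icc s t, HasDerivWithinAt v (companionField (g y) (v y)) (Icc s t) y := by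
    intro y hy
    refine hasDerivWithinAt_pi.2 fun i => ?_
    have hd := hu.hasDerivWithinAt_iteratedDerivWithin hst i.2 hy
    fin_cases i
    · exact hd
    · exact hd
    · exact hd
    · refine hd.congr_deriv ?_
      change iteratedDerivWithin 4 u (Icc s t) y =
        (lam - q y) / (a : ℂ) ^ 4 * iteratedDerivWithin 0 u (Icc s t) y
      rw [iteratedDerivWithin_zero]
      field_simp
      linear_combination hu.2 y hy
  have hcont : ContinuousOn v (Icc s t) := fun y hy => (hv y hy).continuousWithinAt
  have hz : ∀ y S, HasDerivWithinAt (fun _ : ℝ => (0 : Fin 4 → ℂ))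
      (companionField (g y) 0) S y := by
    intro y S
    refine (hasDerivWithinAt_const y S (0 : Fin 4 → ℂ)).congr_deriv ?_
    ext i
    fin_cases i <;> simp [companionField]
  have hvx : v x = 0 := funext fun i => h0 i i.2
  have hright : EqOn v (fun _ => 0) (Icc x t) := by
    have hsub : Icc x t ⊆ Icc s t := Icc_subset_Icc_left hx.1
    refine ODE_solution_unique_of_mem_Icc_right (v := fun y => companionField (g y))
      (s := fun _ => univ) (K := K)
      (fun y hy => hlip y (hsub (Ico_subset_Icc_self hy))) (hcont.mono hsub) (fun y hy => ?_)
      (fun _ _ => mem_univ _) continuousOn_const (fun y _ => hz y _) (fun _ _ => mem_univ _) hvx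
    exact ((hv y (hsub (Ico_subset_Icc_self hy))).mono
      (Icc_subset_Icc_left (hx.1.trans hy.1))).mono_of_mem_nhdsWithin (Icc_mem_nhdsGE hy.2)
  have hleft : EqOn v (fun _ => 0) (Icc s x) := by
    have hsub : Icc s x ⊆ Icc s t := Icc_subset_Icc_right hx.2
    refine ODE_solution_unique_of_mem_Icc_left (v := fun y => companionField (g y))
      (s := fun _ => univ) (K := K)
      (fun y hy => hlip y (hsub (Ioc_subset_Icc_self hy))) (hcont.mono hsub) (fun y hy => ?_)
      (fun _ _ => mem_univ _) continuousOn_const (fun y _ => hz y _) (fun _ _ => mem_univ _) hvx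
    exact ((hv y (hsub (Ioc_subset_Icc_self hy))).mono
      (Icc_subset_Icc_right (hy.2.trans hx.2))).mono_of_mem_nhdsWithin (Icc_mem_nhdsLE hy.1)
  intro y hy
  have hvy : v y = 0 := (le_total x y).elim (fun h => hright ⟨h, hy.2⟩) fun h => hleft ⟨hy.1, h⟩
  simpa [v] using congrFun hvy 0

/-- A linear relation between the Cauchy data of solutions at one point persists. -/
theorem linearRelation {u : ι → ℝ → ℂ} (hst : s < t) (ha : a ≠ 0)
    (hq : ContinuousOn q (Icc s t)) (hu : ∀ j, SolvesODE a q lam (Icc s t) (u j)) (c : ι → ℂ)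
    {x : ℝ} (hx : x ∈ Icc s t)
    (h0 : ∀ n < 4, ∑ j, c j * iteratedDerivWithin n (u j) (Icc s t) x = 0)
    {n : ℕ} (hn : n ≤ 4) {y : ℝ} (hy : y ∈ Icc s t) :
    ∑ j, c j * iteratedDerivWithin n (u j) (Icc s t) y = 0 := by
  have hz := (linearCombination hst hu c).eqOn_zero hst ha hq hx fun n hn =>
    (iteratedDerivWithin_linearCombination hst hu c hn.le hx).trans (h0 n hn)
  rw [← iteratedDerivWithin_linearCombination hst hu c hn hy, iteratedDerivWithin_congr hz hy]
  exact iteratedDerivWithin_const_zero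

/-- Two solutions span a space of solutions, with the expected derivatives. -/
theorem exists_combination {f g : ℝ → ℂ} (hst : s < t) (hf : SolvesODE a q lam (Icc s t) f)
    (hg : SolvesODE a q lam (Icc s t) g) (c d : ℂ) :
    ∃ u, SolvesODE a q lam (Icc s t) u ∧ ∀ n ≤ 4, ∀ y ∈ Icc s t,
      iteratedDerivWithin n u (Icc s t) y =
        c * iteratedDerivWithin n f (Icc s t) y + d * iteratedDerivWithin n g (Icc s t) y := by
  have hfg : ∀ j, SolvesODE a q lam (Icc s t) ((![f, g] : Fin 2 → ℝ → ℂ) j) :=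
    Fin.forall_fin_two.2 ⟨hf, hg⟩
  refine ⟨_, linearCombination hst hfg ![c, d], fun n hn y hy => ?_⟩
  rw [iteratedDerivWithin_linearCombination hst hfg _ hn hy, Fin.sum_univ_two]
  rfl

/-- A solution whose Cauchy data at one point are a combination of those of two other solutions
is that combination everywhere. -/
theorem eq_combination {u f g : ℝ → ℂ} (hst : s < t) (ha : a ≠ 0)
    (hq : ContinuousOn q (Icc s t)) (hu : SolvesODE a q lam (Icc s t) u)
    (hf : SolvesODE a q lam (Icc s t) f) (hg : SolvesODE a q lam (Icc s t) g) (c d : ℂ)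
    {x : ℝ} (hx : x ∈ Icc s t)
    (h0 : ∀ n < 4, iteratedDerivWithin n u (Icc s t) x =
      c * iteratedDerivWithin n f (Icc s t) x + d * iteratedDerivWithin n g (Icc s t) x)
    {n : ℕ} (hn : n ≤ 4) {y : ℝ} (hy : y ∈ Icc s t) :
    iteratedDerivWithin n u (Icc s t) y =
      c * iteratedDerivWithin n f (Icc s t) y + d * iteratedDerivWithin n g (Icc s t) y := by
  have hufg : ∀ j, SolvesODE a q lam (Icc s t) ((![u, f, g] : Fin 3 → ℝ → ℂ) j) := by
    intro j
    fin_cases j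
    exacts [hu, hf, hg]
  have h := linearRelation hst ha hq hufg ![-1, c, d] hx (fun n hn => by
    simp only [Fin.sum_univ_three, Matrix.cons_val]
    linear_combination -h0 n hn) hn hy
  simp only [Fin.sum_univ_three, Matrix.cons_val] at h
  linear_combination -h

end SolvesODE

/-- Theorem 3.2: the eigenvalues of the problem (P) are exactly the zeros of the
characteristic function `W(λ)`, the Wronskian of the fundamental solutions
`φ11, φ21, χ11, χ21`. -/
theorem eigenvalue_iff_charFunction_zero
    (a1 a2 β1 β2 δ1 δ2 : ℝ) (ha1 : 0 < a1) (ha2 : 0 < a2)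
    (hβ : |β1| + |β2| ≠ 0) (hδ : |δ1| + |δ2| ≠ 0) (q : ℝ → ℝ)
    (hq1 : ContinuousOn q (Icc (-1 : ℝ) 0)) (hq2 : ContinuousOn q (Icc (0 : ℝ) 1))
    (lam : ℂ) (φ11 φ21 χ12 χ22 χ11 χ21 : ℝ → ℂ)
    (hφ11 : SolvesODE a1 q lam (Icc (-1 : ℝ) 0) φ11)
    (hφ11i : φ11 (-1) = 0 ∧ iteratedDerivWithin 1 φ11 (Icc (-1 : ℝ) 0) (-1) = 0 ∧
      iteratedDerivWithin 2 φ11 (Icc (-1 : ℝ) 0) (-1) = 0 ∧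
      iteratedDerivWithin 3 φ11 (Icc (-1 : ℝ) 0) (-1) = -1)
    (hφ21 : SolvesODE a1 q lam (Icc (-1 : ℝ) 0) φ21)
    (hφ21i : φ21 (-1) = 0 ∧ iteratedDerivWithin 1 φ21 (Icc (-1 : ℝ) 0) (-1) = (β2 : ℂ) ∧
      iteratedDerivWithin 2 φ21 (Icc (-1 : ℝ) 0) (-1) = -(β1 : ℂ) ∧
      iteratedDerivWithin 3 φ21 (Icc (-1 : ℝ) 0) (-1) = 0)
    (hχ12 : SolvesODE a2 q lam (Icc (0 : ℝ) 1) χ12)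
    (hχ12i : χ12 1 = -1 ∧ iteratedDerivWithin 1 χ12 (Icc (0 : ℝ) 1) 1 = 0 ∧
      iteratedDerivWithin 2 χ12 (Icc (0 : ℝ) 1) 1 = 0 ∧
      iteratedDerivWithin 3 χ12 (Icc (0 : ℝ) 1) 1 = lam)
    (hχ22 : SolvesODE a2 q lam (Icc (0 : ℝ) 1) χ22)
    (hχ22i : χ22 1 = 0 ∧ iteratedDerivWithin 1 χ22 (Icc (0 : ℝ) 1) 1 = -1 ∧
      iteratedDerivWithin 2 χ22 (Icc (0 : ℝ) 1) 1 = lam ∧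
      iteratedDerivWithin 3 χ22 (Icc (0 : ℝ) 1) 1 = 0)
    (hχ11 : SolvesODE a1 q lam (Icc (-1 : ℝ) 0) χ11)
    (hχ11i : χ11 0 = χ12 0 ∧
      iteratedDerivWithin 1 χ11 (Icc (-1 : ℝ) 0) 0 = iteratedDerivWithin 1 χ12 (Icc (0 : ℝ) 1) 0 ∧
      iteratedDerivWithin 2 χ11 (Icc (-1 : ℝ) 0) 0 = iteratedDerivWithin 2 χ12 (Icc (0 : ℝ) 1) 0
        + lam * (δ1 : ℂ) * iteratedDerivWithin 1 χ12 (Icc (0 : ℝ) 1) 0 ∧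
      iteratedDerivWithin 3 χ11 (Icc (-1 : ℝ) 0) 0 = iteratedDerivWithin 3 χ12 (Icc (0 : ℝ) 1) 0
        + lam * (δ2 : ℂ) * χ12 0)
    (hχ21 : SolvesODE a1 q lam (Icc (-1 : ℝ) 0) χ21)
    (hχ21i : χ21 0 = χ22 0 ∧
      iteratedDerivWithin 1 χ21 (Icc (-1 : ℝ) 0) 0 = iteratedDerivWithin 1 χ22 (Icc (0 : ℝ) 1) 0 ∧
      iteratedDerivWithin 2 χ21 (Icc (-1 : ℝ) 0) 0 = iteratedDerivWithin 2 χ22 (Icc (0 : ℝ) 1) 0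
        + lam * (δ1 : ℂ) * iteratedDerivWithin 1 χ22 (Icc (0 : ℝ) 1) 0 ∧
      iteratedDerivWithin 3 χ21 (Icc (-1 : ℝ) 0) 0 = iteratedDerivWithin 3 χ22 (Icc (0 : ℝ) 1) 0
        + lam * (δ2 : ℂ) * χ22 0) :
    ∀ x ∈ Icc (-1 : ℝ) 0,
      (IsEigenvalue a1 a2 β1 β2 δ1 δ2 q lam ↔
        Matrix.det (Matrix.of fun i j : Fin 4 =>
          iteratedDerivWithin (i : ℕ) (![φ11, φ21, χ11, χ21] j) (Icc (-1 : ℝ) 0) x) = 0) := by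
  intro x hx
  have hst1 : (-1 : ℝ) < 0 := by norm_num
  have hst2 : (0 : ℝ) < 1 := one_pos
  have hmem1 : (-1 : ℝ) ∈ Icc (-1 : ℝ) 0 := left_mem_Icc.2 hst1.le
  have hmem0 : (0 : ℝ) ∈ Icc (-1 : ℝ) 0 := right_mem_Icc.2 hst1.le
  have hmem0' : (0 : ℝ) ∈ Icc (0 : ℝ) 1 := left_mem_Icc.2 hst2.le
  have hmem1' : (1 : ℝ) ∈ Icc (0 : ℝ) 1 := right_mem_Icc.2 hst2.le
  obtain ⟨hφ1a, hφ1b, hφ1c, hφ1d⟩ := hφ11i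
  obtain ⟨hφ2a, hφ2b, hφ2c, hφ2d⟩ := hφ21i
  obtain ⟨hχ1a, hχ1b, hχ1c, hχ1d⟩ := hχ12i
  obtain ⟨hχ2a, hχ2b, hχ2c, hχ2d⟩ := hχ22i
  obtain ⟨hj1a, hj1b, hj1c, hj1d⟩ := hχ11i
  obtain ⟨hj2a, hj2b, hj2c, hj2d⟩ := hχ21i
  have hβsq : (β1 : ℂ) ^ 2 + (β2 : ℂ) ^ 2 ≠ 0 := by
    have : β1 ^ 2 + β2 ^ 2 ≠ 0 := fun h => hβ <| by
      have h1 : β1 = 0 := by nlinarith [sq_nonneg β1, sq_nonneg β2]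
      have h2 : β2 = 0 := by nlinarith [sq_nonneg β1, sq_nonneg β2]
      simp [h1, h2]
    exact_mod_cast this
  rw [← Matrix.exists_mulVec_eq_zero_iff]
  constructor
  · rintro ⟨u1, u2, hu1, hu2, hne, hb0, hb1, ht0, ht1, ht2, ht3, he3, he2⟩
    set p := iteratedDerivWithin 1 u1 (Icc (-1 : ℝ) 0) (-1) with hp
    set r := iteratedDerivWithin 2 u1 (Icc (-1 : ℝ) 0) (-1) with hr
    set c := -iteratedDerivWithin 3 u1 (Icc (-1 : ℝ) 0) (-1) with hc
    set d := (β2 * p - β1 * r) / ((β1 : ℂ) ^ 2 + (β2 : ℂ) ^ 2) with hd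
    set A := -u2 1 with hA
    set B := -iteratedDerivWithin 1 u2 (Icc (0 : ℝ) 1) 1 with hB
    have hφ := fun n (hn : n ≤ 4) y (hy : y ∈ Icc (-1 : ℝ) 0) =>
      hu1.eq_combination hst1 ha1.ne' hq1 hφ11 hφ21 c d hmem1 (fun n hn => by
        interval_cases n
        · simp only [iteratedDerivWithin_zero, hb0, hφ1a, hφ2a]
          ring
        · rw [hφ1b, hφ2b, ← hp, hd]
          field_simp
          linear_combination β1 * hb1
        · rw [hφ1c, hφ2c, ← hr, hd]
          field_simp
          linear_combination β2 * hb1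
        · rw [hφ1d, hφ2d, hc]
          ring) hn hy
    have hχ := fun n (hn : n ≤ 4) y (hy : y ∈ Icc (0 : ℝ) 1) =>
      hu2.eq_combination hst2 ha2.ne' hq2 hχ12 hχ22 A B hmem1' (fun n hn => by
        interval_cases n
        · simp only [iteratedDerivWithin_zero, hχ1a, hχ2a, hA]
          ring
        · rw [hχ1b, hχ2b, hB]
          ring
        · rw [hχ1c, hχ2c, hB]
          linear_combination he2
        · rw [hχ1d, hχ2d, hA]
          linear_combination he3) hn hy
    have k0 := hχ 0 (by norm_num) 0 hmem0'
    have k1 := hχ 1 (by norm_num) 0 hmem0'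
    have k2 := hχ 2 (by norm_num) 0 hmem0'
    have k3 := hχ 3 (by norm_num) 0 hmem0'
    simp only [iteratedDerivWithin_zero] at k0
    have hψ := fun n (hn : n ≤ 4) y (hy : y ∈ Icc (-1 : ℝ) 0) =>
      hu1.eq_combination hst1 ha1.ne' hq1 hχ11 hχ21 A B hmem0 (fun n hn => by
        interval_cases n
        · simp only [iteratedDerivWithin_zero]
          rw [hj1a, hj2a]
          linear_combination k0 - ht0
        · rw [hj1b, hj2b]
          linear_combination k1 - ht1
        · rw [hj1c, hj2c]
          linear_combination k2 - ht2 + lam * δ1 * (k1 - ht1)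
        · rw [hj1d, hj2d]
          linear_combination k3 - ht3 + lam * δ2 * (k0 - ht0)) hn hy
    refine ⟨![c, d, -A, -B], fun h => hne ?_, ?_⟩
    · have hc0 : c = 0 := congrFun h 0
      have hd0 : d = 0 := congrFun h 1
      have hA0 : A = 0 := neg_eq_zero.1 (congrFun h 2)
      have hB0 : B = 0 := neg_eq_zero.1 (congrFun h 3)
      refine ⟨fun y hy => ?_, fun y hy => ?_⟩
      · simpa [hc0, hd0] using hφ 0 (by norm_num) y hy
      · simpa [hA0, hB0] using hχ 0 (by norm_num) y hy
    · ext i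
      have h1 := hφ i i.2.le x hx
      have h2 := hψ i i.2.le x hx
      simp only [Matrix.mulVec, dotProduct, Fin.sum_univ_four, Matrix.of_apply, Matrix.cons_val,
        Pi.zero_apply]
      linear_combination h2 - h1
  · rintro ⟨c, hc0, hc⟩
    have hsol : ∀ j, SolvesODE a1 q lam (Icc (-1 : ℝ) 0)
        ((![φ11, φ21, χ11, χ21] : Fin 4 → ℝ → ℂ) j) := by
      intro j
      fin_cases j
      exacts [hφ11, hφ21, hχ11, hχ21]
    have hrel : ∀ n ≤ 4, ∀ y ∈ Icc (-1 : ℝ) 0,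
        c 0 * iteratedDerivWithin n φ11 (Icc (-1 : ℝ) 0) y
          + c 1 * iteratedDerivWithin n φ21 (Icc (-1 : ℝ) 0) y
          + c 2 * iteratedDerivWithin n χ11 (Icc (-1 : ℝ) 0) y
          + c 3 * iteratedDerivWithin n χ21 (Icc (-1 : ℝ) 0) y = 0 := by
      intro n hn y hy
      have h := SolvesODE.linearRelation hst1 ha1.ne' hq1 hsol c hx (fun m hm => by
        have := congrFun hc ⟨m, hm⟩
        simp only [Matrix.mulVec, dotProduct, Matrix.of_apply, Pi.zero_apply] at this
        rw [← this]
        exact Finset.sum_congr rfl fun _ _ => mul_comm _ _) hn hy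
      simpa only [Fin.sum_univ_four, Matrix.cons_val] using h
    obtain ⟨u1, hu1, hD1⟩ := hφ11.exists_combination hst1 hφ21 (c 0) (c 1)
    obtain ⟨u2, hu2, hD2⟩ := hχ12.exists_combination hst2 hχ22 (-c 2) (-c 3)
    have hv1 : ∀ y ∈ Icc (-1 : ℝ) 0, u1 y = c 0 * φ11 y + c 1 * φ21 y := by
      simpa only [iteratedDerivWithin_zero] using hD1 0 (by norm_num)
    have hv2 : ∀ y ∈ Icc (0 : ℝ) 1, u2 y = -c 2 * χ12 y + -c 3 * χ22 y := by
      simpa only [iteratedDerivWithin_zero] using hD2 0 (by norm_num)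
    have r0 := hrel 0 (by norm_num) 0 hmem0
    have r1 := hrel 1 (by norm_num) 0 hmem0
    have r2 := hrel 2 (by norm_num) 0 hmem0
    have r3 := hrel 3 (by norm_num) 0 hmem0
    simp only [iteratedDerivWithin_zero] at r0
    rw [hj1a, hj2a] at r0
    rw [hj1b, hj2b] at r1
    rw [hj1c, hj2c] at r2
    rw [hj1d, hj2d] at r3
    refine ⟨u1, u2, hu1, hu2, ?_, ?_, ?_, ?_, ?_, ?_, ?_, ?_, ?_⟩
    · rintro ⟨hz1, hz2⟩
      have z1 : ∀ n, iteratedDerivWithin n u1 (Icc (-1 : ℝ) 0) (-1) = 0 := fun n =>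
        (iteratedDerivWithin_congr hz1 hmem1).trans iteratedDerivWithin_const_zero
      have z2 : ∀ n, iteratedDerivWithin n u2 (Icc (0 : ℝ) 1) 1 = 0 := fun n =>
        (iteratedDerivWithin_congr hz2 hmem1').trans iteratedDerivWithin_const_zero
      have e0 := hv2 1 hmem1'
      have e1 := hD2 1 (by norm_num) 1 hmem1'
      have f1 := hD1 1 (by norm_num) (-1) hmem1
      have f2 := hD1 2 (by norm_num) (-1) hmem1
      have f3 := hD1 3 (by norm_num) (-1) hmem1
      rw [hz2 hmem1', hχ1a, hχ2a, Pi.zero_apply] at e0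
      rw [z2, hχ1b, hχ2b] at e1
      rw [z1, hφ1b, hφ2b] at f1
      rw [z1, hφ1c, hφ2c] at f2
      rw [z1, hφ1d, hφ2d] at f3
      have g1 : c 1 = 0 := (mul_eq_zero.1 (show c 1 * ((β1 : ℂ) ^ 2 + (β2 : ℂ) ^ 2) = 0 by
        linear_combination β1 * f2 - β2 * f1)).resolve_right hβsq
      refine hc0 (funext fun i => ?_)
      fin_cases i
      · change c 0 = 0
        linear_combination f3
      · exact g1
      · change c 2 = 0
        linear_combination -e0
      · change c 3 = 0
        linear_combination -e1
    · rw [hv1 _ hmem1, hφ1a, hφ2a]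
      ring
    · rw [hD1 1 (by norm_num) _ hmem1, hD1 2 (by norm_num) _ hmem1, hφ1b, hφ2b, hφ1c, hφ2c]
      ring
    · rw [hv1 _ hmem0, hv2 _ hmem0']
      linear_combination -r0
    · rw [hD1 1 (by norm_num) _ hmem0, hD2 1 (by norm_num) _ hmem0']
      linear_combination -r1
    · rw [hD1 1 (by norm_num) _ hmem0, hD1 2 (by norm_num) _ hmem0, hD2 2 (by norm_num) _ hmem0']
      linear_combination lam * δ1 * r1 - r2
    · rw [hv1 _ hmem0, hD1 3 (by norm_num) _ hmem0, hD2 3 (by norm_num) _ hmem0']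
      linear_combination lam * δ2 * r0 - r3
    · rw [hv2 _ hmem1', hD2 3 (by norm_num) _ hmem1', hχ1a, hχ2a, hχ1d, hχ2d]
      ring
    · rw [hD2 1 (by norm_num) _ hmem1', hD2 2 (by norm_num) _ hmem1', hχ1b, hχ2b, hχ1c, hχ2c]
      ring
end

section
/- Let c < d be real numbers, let a > 0, let q : [c,d] → ℝ be continuous, let s ∈ ℂ with s ≠ 0, and set k = s/a. Let u ∈ C⁴([c,d], ℂ) satisfy a⁴·u''''(x) + q(x)·u(x) = s⁴·u(x) on [c,d]. Then for every x ∈ [c,d]: u(x) = u(c)·(cosh(k(x−c)) + cos(k(x−c)))/2 + (u'(c)/k)·(sinh(k(x−c)) + sin(k(x−c)))/2 + (u''(c)/k²)·(cosh(k(x−c)) − cos(k(x−c)))/2 + (u'''(c)/k³)·(sinh(k(x−c)) − sin(k(x−c)))/2 − (1/(2as³))·∫_c^x (sinh(s(x−y)/a) − sin(s(x−y)/a))·q(y)·u(y) dy. -/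
open Set Complex

/-- The derivatives within `[c, d]` of a `C^N` function are successive derivatives. -/
theorem hasDerivWithinAt_iteratedDerivWithin_Icc {c d : ℝ} (hcd : c < d) {u : ℝ → ℂ} {N n : ℕ}
    (hu : ContDiffOn ℝ N u (Icc c d)) (hn : n < N) {y : ℝ} (hy : y ∈ Icc c d) :
    HasDerivWithinAt (iteratedDerivWithin n u (Icc c d))
      (iteratedDerivWithin (n + 1) u (Icc c d) y) (Icc c d) y := by
  rw [iteratedDerivWithin_succ]
  exact (hu.differentiableOn_iteratedDerivWithin (by exact_mod_cast hn)
    (uniqueDiffOn_Icc hcd) y hy).hasDerivWithinAt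

/-- Taylor-type formula for the operator `D^4 - k^4`: a function on `[c, x]` with successive
derivatives `u₁, u₂, u₃, u₄` is the solution of the homogeneous equation with the same data at
`c`, plus the convolution of `u₄ - k^4 u₀` with the impulse response. -/
theorem eq_add_integral_sinh_sub_sin {c x : ℝ} (hcx : c ≤ x) {k : ℂ} (hk : k ≠ 0)
    {u₀ u₁ u₂ u₃ u₄ : ℝ → ℂ}
    (h₀ : ∀ y ∈ Icc c x, HasDerivWithinAt u₀ (u₁ y) (Icc c x) y)
    (h₁ : ∀ y ∈ Icc c x, HasDerivWithinAt u₁ (u₂ y) (Icc c x) y)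
    (h₂ : ∀ y ∈ Icc c x, HasDerivWithinAt u₂ (u₃ y) (Icc c x) y)
    (h₃ : ∀ y ∈ Icc c x, HasDerivWithinAt u₃ (u₄ y) (Icc c x) y)
    (h₄ : ContinuousOn u₄ (Icc c x)) :
    u₀ x =
      u₀ c * (cosh (k * (x - c)) + cos (k * (x - c))) / 2
      + u₁ c / k * (sinh (k * (x - c)) + sin (k * (x - c))) / 2
      + u₂ c / k ^ 2 * (cosh (k * (x - c)) - cos (k * (x - c))) / 2
      + u₃ c / k ^ 3 * (sinh (k * (x - c)) - sin (k * (x - c))) / 2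
      + ∫ y in c..x, (sinh (k * (x - y)) - sin (k * (x - y))) / (2 * k ^ 3)
          * (u₄ y - k ^ 4 * u₀ y) := by
  have hg : ∀ z : ℂ, HasDerivAt (fun z : ℂ => k * (x - z)) (-k) z := fun z => by
    simpa using ((hasDerivAt_id z).const_sub (x : ℂ)).const_mul k
  have hG : ∀ y ∈ Icc c x, HasDerivWithinAt (fun y : ℝ =>
      u₀ y * (cosh (k * (x - y)) + cos (k * (x - y))) / 2
      + u₁ y / k * (sinh (k * (x - y)) + sin (k * (x - y))) / 2
      + u₂ y / k ^ 2 * (cosh (k * (x - y)) - cos (k * (x - y))) / 2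
      + u₃ y / k ^ 3 * (sinh (k * (x - y)) - sin (k * (x - y))) / 2)
      ((sinh (k * (x - y)) - sin (k * (x - y))) / (2 * k ^ 3) * (u₄ y - k ^ 4 * u₀ y))
      (Icc c x) y := by
    intro y hy
    have hch := (hg y).ccosh.comp_ofReal.hasDerivWithinAt (s := Icc c x)
    have hsh := (hg y).csinh.comp_ofReal.hasDerivWithinAt (s := Icc c x)
    have hco := (hg y).ccos.comp_ofReal.hasDerivWithinAt (s := Icc c x)
    have hsi := (hg y).csin.comp_ofReal.hasDerivWithinAt (s := Icc c x)
    refine HasDerivWithinAt.congr_deriv ((((((h₀ y hy).mul (hch.add hco)).div_const 2).add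
      ((((h₁ y hy).div_const k).mul (hsh.add hsi)).div_const 2)).add
      ((((h₂ y hy).div_const (k ^ 2)).mul (hch.sub hco)).div_const 2)).add
      ((((h₃ y hy).div_const (k ^ 3)).mul (hsh.sub hsi)).div_const 2)) ?_
    simp only [Pi.add_apply, Pi.sub_apply]
    field_simp
    ring
  have hu₀ : ContinuousOn u₀ (Icc c x) := fun y hy => (h₀ y hy).continuousWithinAt
  have hint : ContinuousOn (fun y : ℝ => (sinh (k * (x - y)) - sin (k * (x - y))) / (2 * k ^ 3)
      * (u₄ y - k ^ 4 * u₀ y)) (Icc c x) :=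
    ContinuousOn.mul (Continuous.continuousOn (by fun_prop)) (h₄.sub (continuousOn_const.mul hu₀))
  rw [intervalIntegral.integral_eq_sub_of_hasDerivAt_of_le hcx
    (fun y hy => (hG y hy).continuousWithinAt)
    (fun y hy => (hG y (Ioo_subset_Icc_self hy)).hasDerivAt (Icc_mem_nhds hy.1 hy.2))
    (hint.intervalIntegrable_of_Icc hcx)]
  simp only [sub_self, mul_zero, cosh_zero, cos_zero, sinh_zero, sin_zero]
  ring

/-- Variation-of-parameters (Volterra) representation of a solution of
`a^4 u'''' + q u = s^4 u` on `[c,d]` through the fundamental system of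
`u'''' = k^4 u`, `k = s/a`, matched to the initial data at `c`. -/
theorem fourth_order_volterra_representation
    (c d a : ℝ) (hcd : c < d) (ha : 0 < a) (q : ℝ → ℝ)
    (hq : ContinuousOn q (Icc c d)) (s : ℂ) (hs : s ≠ 0)
    (u : ℝ → ℂ) (hu : ContDiffOn ℝ 4 u (Icc c d))
    (hode : ∀ x ∈ Icc c d,
      (a : ℂ) ^ 4 * iteratedDerivWithin 4 u (Icc c d) x + (q x : ℂ) * u x = s ^ 4 * u x) :
    ∀ x ∈ Icc c d,
      u x =
        u c * (Complex.cosh (s / a * (x - c)) + Complex.cos (s / a * (x - c))) / 2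
        + iteratedDerivWithin 1 u (Icc c d) c / (s / a)
            * (Complex.sinh (s / a * (x - c)) + Complex.sin (s / a * (x - c))) / 2
        + iteratedDerivWithin 2 u (Icc c d) c / (s / a) ^ 2
            * (Complex.cosh (s / a * (x - c)) - Complex.cos (s / a * (x - c))) / 2
        + iteratedDerivWithin 3 u (Icc c d) c / (s / a) ^ 3
            * (Complex.sinh (s / a * (x - c)) - Complex.sin (s / a * (x - c))) / 2
        - (1 / (2 * (a : ℂ) * s ^ 3))
            * ∫ y in c..x,
                (Complex.sinh (s * (x - y) / a) - Complex.sin (s * (x - y) / a))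
                  * (q y : ℂ) * u y := by
  intro x hx
  have ha' : (a : ℂ) ≠ 0 := by exact_mod_cast ha.ne'
  have hsub : Icc c x ⊆ Icc c d := Icc_subset_Icc_right hx.2
  have hder : ∀ n < 4, ∀ y ∈ Icc c x, HasDerivWithinAt (iteratedDerivWithin n u (Icc c d))
      (iteratedDerivWithin (n + 1) u (Icc c d) y) (Icc c x) y := fun n hn y hy =>
    (hasDerivWithinAt_iteratedDerivWithin_Icc hcd (N := 4) hu hn (hsub hy)).mono hsub
  have hcont : ContinuousOn (iteratedDerivWithin 4 u (Icc c d)) (Icc c x) :=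
    (hu.continuousOn_iteratedDerivWithin le_rfl (uniqueDiffOn_Icc hcd)).mono hsub
  have hrep := eq_add_integral_sinh_sub_sin hx.1 (div_ne_zero hs ha')
    (hder 0 (by norm_num)) (hder 1 (by norm_num)) (hder 2 (by norm_num)) (hder 3 (by norm_num))
    hcont
  simp only [iteratedDerivWithin_zero, zero_add, Nat.reduceAdd] at hrep
  rw [hrep, sub_eq_add_neg _ (_ * intervalIntegral _ _ _ _), ← neg_mul, ← intervalIntegral.integral_const_mul]
  congr 1
  refine intervalIntegral.integral_congr fun y hy => ?_
  rw [uIcc_of_le hx.1] at hy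
  have hu₄ : iteratedDerivWithin 4 u (Icc c d) y = (s ^ 4 * u y - q y * u y) / (a : ℂ) ^ 4 := by
    rw [eq_div_iff (pow_ne_zero 4 ha')]
    linear_combination hode y (hsub hy)
  have harg : s * ((x : ℂ) - y) / a = s / a * (x - y) := by ring
  simp only [hu₄, harg]
  field_simp
  ring
end

section
/- Fix a1 > 0 and let q : [-1,0] → ℝ be continuous. For s ∈ ℂ with s ≠ 0 let φ11(·,s⁴) be the unique solution of a1⁴u'''' + qu = s⁴u on [-1,0] with φ11(-1) = 0, φ11'(-1) = 0, φ11''(-1) = 0, φ11'''(-1) = -1. Then for each k ∈ {0,1,2,3} there exist constants C > 0 and r₀ > 0 such that for all s ∈ ℂ with |s| ≥ r₀ and all x ∈ [-1,0]: |∂ₓᵏ φ11(x, s⁴)| ≤ C·|s|^{k−1}·e^{|s|(x+1)/a1}. -/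
open Set

/-- The `i`-th iterated derivative of a `C^n` function, `i < n`, has the next one as its right
derivative at every point of `[α, β)`. -/
theorem hasDerivWithinAt_Ici_iteratedDerivWithin {E : Type*} [NormedAddCommGroup E]
    [NormedSpace ℝ E] {α β x : ℝ} {n i : ℕ} {u : ℝ → E} (hu : ContDiffOn ℝ n u (Icc α β))
    (hi : i < n) (hx : x ∈ Ico α β) :
    HasDerivWithinAt (iteratedDerivWithin i u (Icc α β))
      (iteratedDerivWithin (i + 1) u (Icc α β) x) (Ici x) x := by
  have hS : UniqueDiffOn ℝ (Icc α β) := uniqueDiffOn_Icc (hx.1.trans_lt hx.2)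
  have hd := hu.differentiableOn_iteratedDerivWithin (m := i) (by exact_mod_cast hi) hS x
    (Ico_subset_Icc_self hx)
  rw [iteratedDerivWithin_succ]
  exact hd.hasDerivWithinAt.mono_of_mem_nhdsWithin (Icc_mem_nhdsGE_of_mem hx)

/-- Gronwall's inequality for a fourth order equation, with the derivatives rescaled by powers
of `σ`. -/
theorem norm_iteratedDerivWithin_le_of_fourth_order {α β σ K δ : ℝ} {u : ℝ → ℂ}
    (hαβ : α < β) (hσ : 0 < σ) (hK : σ ≤ K) (hδ : 0 ≤ δ)
    (hu : ContDiffOn ℝ 4 u (Icc α β))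
    (h0 : ∀ i < 4, ‖iteratedDerivWithin i u (Icc α β) α‖ ≤ σ ^ i * δ)
    (h4 : ∀ x ∈ Icc α β, ‖iteratedDerivWithin 4 u (Icc α β) x‖ ≤ σ ^ 3 * K * ‖u x‖)
    {k : ℕ} (hk : k < 4) {x : ℝ} (hx : x ∈ Icc α β) :
    ‖iteratedDerivWithin k u (Icc α β) x‖ ≤ σ ^ k * (δ * Real.exp (K * (x - α))) := by
  set D : ℕ → ℝ → ℂ := fun i => iteratedDerivWithin i u (Icc α β) with hD
  let f : ℝ → Fin 4 → ℂ := fun x i => (σ ^ (i : ℕ))⁻¹ • D i x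
  let f' : ℝ → Fin 4 → ℂ := fun x i => (σ ^ (i : ℕ))⁻¹ • D (i + 1) x
  have hK0 : 0 ≤ K := hσ.le.trans hK
  have hnorm : ∀ x i, ‖f x i‖ = (σ ^ (i : ℕ))⁻¹ * ‖D i x‖ := fun x i => by
    simp [f, abs_of_pos hσ]
  have hnorm' : ∀ x i, ‖f' x i‖ = (σ ^ (i : ℕ))⁻¹ * ‖D (i + 1) x‖ := fun x i => by
    simp [f', abs_of_pos hσ]
  have hcont : ContinuousOn f (Icc α β) := by
    refine continuousOn_pi.2 fun i => ?_
    exact (hu.continuousOn_iteratedDerivWithin (by exact_mod_cast i.2.le)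
      (uniqueDiffOn_Icc hαβ)).const_smul (σ ^ (i : ℕ))⁻¹
  have hderiv : ∀ x ∈ Ico α β, HasDerivWithinAt f (f' x) (Ici x) x := fun x hx =>
    hasDerivWithinAt_pi.2 fun i =>
      (hasDerivWithinAt_Ici_iteratedDerivWithin (n := 4) (by exact_mod_cast hu) i.2 hx).const_smul
        (σ ^ (i : ℕ))⁻¹
  have hinit : ‖f α‖ ≤ δ := by
    refine (pi_norm_le_iff_of_nonneg hδ).2 fun i => ?_
    rw [hnorm, inv_mul_le_iff₀ (by positivity)]
    exact h0 i i.2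
  have hbound : ∀ x ∈ Ico α β, ‖f' x‖ ≤ K * ‖f x‖ + 0 := by
    intro x hx
    rw [add_zero]
    have hstep : ∀ j : Fin 4, (σ ^ (j : ℕ))⁻¹ * ‖D j x‖ ≤ ‖f x‖ := fun j => by
      rw [← hnorm]
      exact norm_le_pi_norm (f x) j
    refine (pi_norm_le_iff_of_nonneg (by positivity)).2 fun i => ?_
    rw [hnorm']
    by_cases hi : (i : ℕ) + 1 < 4
    · have h1 := hstep ⟨i + 1, hi⟩
      calc (σ ^ (i : ℕ))⁻¹ * ‖D (i + 1) x‖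
          = σ * ((σ ^ ((i : ℕ) + 1))⁻¹ * ‖D (i + 1) x‖) := by field_simp; ring
        _ ≤ K * ‖f x‖ := by gcongr
    · have hi3 : (i : ℕ) = 3 := by omega
      have h1 := hstep 0
      have h2 := h4 x (Ico_subset_Icc_self hx)
      simp only [Fin.val_zero, pow_zero, inv_one, one_mul, hD, iteratedDerivWithin_zero] at h1
      rw [hi3, inv_mul_le_iff₀ (by positivity)]
      calc ‖D (3 + 1) x‖ ≤ σ ^ 3 * K * ‖u x‖ := h2
        _ ≤ σ ^ 3 * (K * ‖f x‖) := by rw [mul_assoc]; gcongr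
  have hg := norm_le_gronwallBound_of_norm_deriv_right_le hcont hderiv hinit hbound x hx
  rw [gronwallBound_ε0] at hg
  have hfk := (norm_le_pi_norm (f x) ⟨k, hk⟩).trans hg
  rwa [hnorm, inv_mul_le_iff₀ (by positivity)] at hfk

/-- Estimate (4.5) of Lemma 4.2: growth of `φ11(·, s⁴)` (the solution on `[-1,0]`
with initial data `(0,0,0,-1)` at `-1`) and its first three derivatives. -/
theorem phi11_asymptotic_bound
    (a1 : ℝ) (ha1 : 0 < a1) (q : ℝ → ℝ)
    (hq : ContinuousOn q (Icc (-1 : ℝ) 0)) :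
    ∀ k : ℕ, k ≤ 3 →
      ∃ C > (0 : ℝ), ∃ r₀ > (0 : ℝ), ∀ s : ℂ, r₀ ≤ ‖s‖ →
        ∀ φ11 : ℝ → ℂ,
          SolvesODE a1 q (s ^ 4) (Icc (-1 : ℝ) 0) φ11 →
          φ11 (-1) = 0 →
          iteratedDerivWithin 1 φ11 (Icc (-1 : ℝ) 0) (-1) = 0 →
          iteratedDerivWithin 2 φ11 (Icc (-1 : ℝ) 0) (-1) = 0 →
          iteratedDerivWithin 3 φ11 (Icc (-1 : ℝ) 0) (-1) = -1 →
          ∀ x ∈ Icc (-1 : ℝ) 0,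
            ‖iteratedDerivWithin k φ11 (Icc (-1 : ℝ) 0) x‖
              ≤ C * ‖s‖ ^ ((k : ℝ) - 1) * Real.exp (‖s‖ * (x + 1) / a1) := by
  intro k hk
  obtain ⟨M, hM⟩ := isCompact_Icc.exists_bound_of_continuousOn hq
  have hM0 : 0 ≤ M := (norm_nonneg _).trans (hM 0 (by norm_num))
  refine ⟨(a1 ^ k)⁻¹ * a1 ^ 3 * Real.exp (M / a1), by positivity, 1, one_pos, ?_⟩
  intro s hs u hu h0 h1 h2 h3 x hx
  set r := ‖s‖ with hr
  have hr0 : 0 < r := one_pos.trans_le hs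
  have key := norm_iteratedDerivWithin_le_of_fourth_order (α := -1) (β := 0) (σ := r / a1)
    (K := r / a1 + M / (a1 * r ^ 3)) (δ := ((r / a1) ^ 3)⁻¹) (u := u) (by norm_num)
    (by positivity) (le_add_of_nonneg_right (by positivity)) (by positivity) hu.1
    (by
      intro i hi
      interval_cases i
      · simp only [iteratedDerivWithin_zero, h0, norm_zero]; positivity
      · rw [h1, norm_zero]; positivity
      · rw [h2, norm_zero]; positivity
      · rw [h3, norm_neg, norm_one, mul_inv_cancel₀ (by positivity)])
    (by
      intro y hy
      have hy4 : (a1 : ℂ) ^ 4 * iteratedDerivWithin 4 u (Icc (-1 : ℝ) 0) y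
          = (s ^ 4 - (q y : ℂ)) * u y := by linear_combination hu.2 y hy
      have hn := congrArg norm hy4
      rw [norm_mul, norm_mul, norm_pow, Complex.norm_real, Real.norm_of_nonneg ha1.le] at hn
      have hc : ‖s ^ 4 - (q y : ℂ)‖ ≤ r ^ 4 + M := by
        refine (norm_sub_le _ _).trans ?_
        rw [norm_pow, Complex.norm_real]
        exact add_le_add le_rfl (hM y hy)
      have hle : a1 ^ 4 * ‖iteratedDerivWithin 4 u (Icc (-1 : ℝ) 0) y‖
          ≤ (r ^ 4 + M) * ‖u y‖ := hn.trans_le (by gcongr)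
      rw [← le_div_iff₀' (by positivity)] at hle
      refine hle.trans_eq ?_
      field_simp)
    (k := k) (by omega) hx
  have hexp : Real.exp ((r / a1 + M / (a1 * r ^ 3)) * (x - -1))
      ≤ Real.exp (M / a1) * Real.exp (r * (x + 1) / a1) := by
    rw [← Real.exp_add]
    refine Real.exp_le_exp.2 ?_
    have hx1 : x + 1 ≤ 1 := by linarith [hx.2]
    have hx0 : 0 ≤ x + 1 := by linarith [hx.1]
    have hr3 : a1 ≤ a1 * r ^ 3 := le_mul_of_one_le_right ha1.le (one_le_pow₀ hs)
    have hdiv : M / (a1 * r ^ 3) ≤ M / a1 := by gcongr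
    have hmul : M / (a1 * r ^ 3) * (x + 1) ≤ M / a1 :=
      (mul_le_of_le_one_right (by positivity) hx1).trans hdiv
    calc (r / a1 + M / (a1 * r ^ 3)) * (x - -1)
        = M / (a1 * r ^ 3) * (x + 1) + r * (x + 1) / a1 := by ring
      _ ≤ _ := by gcongr
  have hpow : r ^ k * (r ^ 3)⁻¹ ≤ r ^ ((k : ℝ) - 1) := by
    rw [Real.rpow_sub hr0, Real.rpow_natCast, Real.rpow_one, div_eq_mul_inv]
    gcongr
    exact le_self_pow₀ hs (by norm_num)
  calc ‖iteratedDerivWithin k u (Icc (-1 : ℝ) 0) x‖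
      ≤ (r / a1) ^ k * (((r / a1) ^ 3)⁻¹ *
          Real.exp ((r / a1 + M / (a1 * r ^ 3)) * (x - -1))) := key
    _ ≤ (r / a1) ^ k * (((r / a1) ^ 3)⁻¹ *
          (Real.exp (M / a1) * Real.exp (r * (x + 1) / a1))) := by gcongr
    _ = (a1 ^ k)⁻¹ * a1 ^ 3 * Real.exp (M / a1) * (r ^ k * (r ^ 3)⁻¹)
          * Real.exp (r * (x + 1) / a1) := by
        rw [div_pow, div_pow, inv_div]; ring
    _ ≤ _ := by gcongr
end

section
/- Fix a1 > 0, real numbers β1, β2 with |β1| + |β2| ≠ 0, and let q : [-1,0] → ℝ be continuous. For s ∈ ℂ with s ≠ 0 let φ21(·,s⁴) be the unique solution of a1⁴u'''' + qu = s⁴u on [-1,0] with φ21(-1) = 0, φ21'(-1) = β2, φ21''(-1) = -β1, φ21'''(-1) = 0. Then for each k ∈ {0,1,2,3} there exist constants C > 0 and r₀ > 0 such that for all s ∈ ℂ with |s| ≥ r₀ and all x ∈ [-1,0]: |∂ₓᵏ φ21(x, s⁴)| ≤ C·|s|^{k−1}·e^{|s|(x+1)/a1}. -/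
open Set

/-- Growth of the derivatives of a solution whose scaled initial data
`u⁽ⁱ⁾(-1) / ρ^i` are bounded by `δ`, where `ρ` is the modulus of the characteristic exponents. -/
lemma SolvesODE.norm_iteratedDerivWithin_le {a ρ M δ : ℝ} {q : ℝ → ℝ} {lam : ℂ} {u : ℝ → ℂ}
    (ha : 0 < a) (hρ : 1 ≤ ρ) (hlam : ‖lam‖ = (a * ρ) ^ 4)
    (hM : ∀ x ∈ Icc (-1 : ℝ) 0, ‖q x‖ ≤ M)
    (hu : SolvesODE a q lam (Icc (-1 : ℝ) 0) u)
    (hδ : ∀ i < 4, ‖iteratedDerivWithin i u (Icc (-1 : ℝ) 0) (-1)‖ ≤ ρ ^ i * δ)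
    {k : ℕ} (hk : k < 4) {x : ℝ} (hx : x ∈ Icc (-1 : ℝ) 0) :
    ‖iteratedDerivWithin k u (Icc (-1 : ℝ) 0) x‖
      ≤ ρ ^ k * (δ * Real.exp ((ρ + M / a ^ 4) * (x + 1))) := by
  obtain ⟨hcont, hode⟩ := hu
  set S := Icc (-1 : ℝ) 0
  have hS : UniqueDiffOn ℝ S := uniqueDiffOn_Icc (by norm_num)
  have hρ0 : 0 < ρ := by linarith
  have hM0 : 0 ≤ M := (norm_nonneg _).trans (hM x hx)
  let f : ℝ → Fin 4 → ℂ := fun t i => ((ρ ^ (i : ℕ))⁻¹ : ℝ) • iteratedDerivWithin i u S t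
  let f' : ℝ → Fin 4 → ℂ := fun t i => ((ρ ^ (i : ℕ))⁻¹ : ℝ) • iteratedDerivWithin (i + 1) u S t
  have hf : ∀ t ∈ S, ∀ i < 4, ‖iteratedDerivWithin i u S t‖ ≤ ρ ^ i * ‖f t‖ := by
    intro t _ i hi
    have h := norm_le_pi_norm (f t) ⟨i, hi⟩
    simp only [f, norm_smul, norm_inv, norm_pow, Real.norm_of_nonneg hρ0.le] at h
    rwa [inv_mul_le_iff₀ (by positivity)] at h
  have hderiv : ∀ t ∈ S, HasDerivWithinAt f (f' t) S t := by
    intro t ht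
    refine hasDerivWithinAt_pi.2 fun i => ?_
    simp only [f, f']
    rw [iteratedDerivWithin_succ]
    refine (hcont.differentiableOn_iteratedDerivWithin ?_ hS t ht).hasDerivWithinAt.fun_const_smul _
    exact_mod_cast i.2
  have hfour : ∀ t ∈ S, ‖iteratedDerivWithin 4 u S t‖ ≤ (ρ ^ 4 + M / a ^ 4) * ‖f t‖ := by
    intro t ht
    have h0 : ‖u t‖ ≤ ‖f t‖ := by simpa using hf t ht 0 (by norm_num)
    have h1 : (a : ℂ) ^ 4 * iteratedDerivWithin 4 u S t = (lam - q t) * u t := by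
      linear_combination hode t ht
    have h2 : a ^ 4 * ‖iteratedDerivWithin 4 u S t‖ ≤ ((a * ρ) ^ 4 + M) * ‖f t‖ := by
      have h3 := congrArg norm h1
      rw [norm_mul, norm_mul, norm_pow, Complex.norm_of_nonneg ha.le] at h3
      rw [h3]
      refine mul_le_mul ((norm_sub_le _ _).trans ?_) h0 (norm_nonneg _) (by positivity)
      rw [hlam, Complex.norm_real]
      gcongr
      exact hM t ht
    have h4 : ((a * ρ) ^ 4 + M) * ‖f t‖ = a ^ 4 * ((ρ ^ 4 + M / a ^ 4) * ‖f t‖) := by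
      field_simp
    rw [h4] at h2
    exact le_of_mul_le_mul_left h2 (by positivity)
  have hbound : ∀ t ∈ S, ‖f' t‖ ≤ (ρ + M / a ^ 4) * ‖f t‖ := by
    intro t ht
    have hK : 0 ≤ M / a ^ 4 := by positivity
    refine (pi_norm_le_iff_of_nonneg (by positivity)).2 fun i => ?_
    simp only [f', norm_smul, norm_inv, norm_pow, Real.norm_of_nonneg hρ0.le]
    rw [inv_mul_le_iff₀ (by positivity), ← mul_assoc]
    have hone : 1 ≤ ρ ^ (i : ℕ) := one_le_pow₀ hρ
    have hstep : ‖iteratedDerivWithin (i + 1) u S t‖ ≤ (ρ ^ ((i : ℕ) + 1) + M / a ^ 4) * ‖f t‖ := by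
      rcases Nat.lt_or_ge ((i : ℕ) + 1) 4 with hi | hi
      · refine (hf t ht _ hi).trans ?_
        gcongr
        linarith
      · have : (i : ℕ) + 1 = 4 := by omega
        rw [this]
        exact hfour t ht
    refine hstep.trans ?_
    gcongr
    rw [pow_succ]
    nlinarith
  have hinit : ‖f (-1)‖ ≤ δ := by
    have hδ0 : 0 ≤ δ := by simpa using (norm_nonneg _).trans (hδ 0 (by norm_num))
    refine (pi_norm_le_iff_of_nonneg hδ0).2 fun i => ?_
    simp only [f, norm_smul, norm_inv, norm_pow, Real.norm_of_nonneg hρ0.le]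
    rw [inv_mul_le_iff₀ (by positivity)]
    exact hδ i i.2
  have hgron := norm_le_gronwallBound_of_norm_deriv_right_le (K := ρ + M / a ^ 4) (ε := 0)
    (fun t ht => (hderiv t ht).continuousWithinAt)
    (fun t ht => (hderiv t (Ico_subset_Icc_self ht)).mono_of_mem_nhdsWithin
      (Icc_mem_nhdsGE_of_mem ht)) hinit
    (fun t ht => by simpa using hbound t (Ico_subset_Icc_self ht)) x hx
  rw [gronwallBound_ε0, sub_neg_eq_add] at hgron
  refine (hf x hx k hk).trans ?_
  gcongr

/-- Part of Lemma 4.2: growth of `φ21(·, s⁴)` (the solution on `[-1,0]`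
with initial data `(0, β2, -β1, 0)` at `-1`) and its first three derivatives. -/
theorem phi21_asymptotic_bound
    (a1 β1 β2 : ℝ) (ha1 : 0 < a1) (hβ : |β1| + |β2| ≠ 0) (q : ℝ → ℝ)
    (hq : ContinuousOn q (Icc (-1 : ℝ) 0)) :
    ∀ k : ℕ, k ≤ 3 →
      ∃ C > (0 : ℝ), ∃ r₀ > (0 : ℝ), ∀ s : ℂ, r₀ ≤ ‖s‖ →
        ∀ φ21 : ℝ → ℂ,
          SolvesODE a1 q (s ^ 4) (Icc (-1 : ℝ) 0) φ21 →
          φ21 (-1) = 0 →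
          iteratedDerivWithin 1 φ21 (Icc (-1 : ℝ) 0) (-1) = (β2 : ℂ) →
          iteratedDerivWithin 2 φ21 (Icc (-1 : ℝ) 0) (-1) = -(β1 : ℂ) →
          iteratedDerivWithin 3 φ21 (Icc (-1 : ℝ) 0) (-1) = 0 →
          ∀ x ∈ Icc (-1 : ℝ) 0,
            ‖iteratedDerivWithin k φ21 (Icc (-1 : ℝ) 0) x‖
              ≤ C * ‖s‖ ^ ((k : ℝ) - 1) * Real.exp (‖s‖ * (x + 1) / a1) := by
  intro k hk
  obtain ⟨M, hM⟩ := isCompact_Icc.exists_bound_of_continuousOn hq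
  have hD : 0 < |β1| + |β2| := lt_of_le_of_ne (by positivity) hβ.symm
  have hM0 : 0 ≤ M := (norm_nonneg _).trans (hM 0 (by norm_num))
  refine ⟨(|β1| + |β2|) * Real.exp (M / a1 ^ 4) / a1 ^ ((k : ℝ) - 1), by positivity, a1, ha1, ?_⟩
  intro s hs φ hφ h0 h1 h2 h3 x hx
  set ρ := ‖s‖ / a1 with hρdef
  have hρ : 1 ≤ ρ := (one_le_div ha1).2 hs
  have hρ0 : 0 < ρ := by linarith
  have hlam : ‖s ^ 4‖ = (a1 * ρ) ^ 4 := by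
    rw [norm_pow, hρdef, mul_div_cancel₀ _ ha1.ne']
  have hmain := hφ.norm_iteratedDerivWithin_le (δ := (|β1| + |β2|) / ρ) ha1 hρ hlam hM ?_
    (Nat.lt_succ_of_le hk) hx
  · refine hmain.trans ?_
    have hpow : ρ ^ k / ρ = ‖s‖ ^ ((k : ℝ) - 1) / a1 ^ ((k : ℝ) - 1) := by
      rw [← Real.div_rpow (norm_nonneg s) ha1.le, ← hρdef, Real.rpow_sub_one hρ0.ne',
        Real.rpow_natCast]
    have hexp : Real.exp ((ρ + M / a1 ^ 4) * (x + 1))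
        ≤ Real.exp (M / a1 ^ 4) * Real.exp (‖s‖ * (x + 1) / a1) := by
      rw [← Real.exp_add, Real.exp_le_exp]
      have : M / a1 ^ 4 * (x + 1) ≤ M / a1 ^ 4 :=
        mul_le_of_le_one_right (by positivity) (by linarith [hx.2])
      have : ‖s‖ * (x + 1) / a1 = ρ * (x + 1) := by rw [hρdef]; ring
      linarith
    calc ρ ^ k * ((|β1| + |β2|) / ρ * Real.exp ((ρ + M / a1 ^ 4) * (x + 1)))
        = (ρ ^ k / ρ) * (|β1| + |β2|) * Real.exp ((ρ + M / a1 ^ 4) * (x + 1)) := by ring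
      _ ≤ (ρ ^ k / ρ) * (|β1| + |β2|)
          * (Real.exp (M / a1 ^ 4) * Real.exp (‖s‖ * (x + 1) / a1)) := by gcongr
      _ = _ := by rw [hpow]; ring
  · intro i hi
    interval_cases i
    · simp only [iteratedDerivWithin_zero, h0, norm_zero]
      positivity
    · rw [h1, Complex.norm_real, Real.norm_eq_abs, pow_one, mul_div_cancel₀ _ hρ0.ne']
      linarith [abs_nonneg β1]
    · rw [h2, norm_neg, Complex.norm_real, Real.norm_eq_abs]
      have : ρ ^ 2 * ((|β1| + |β2|) / ρ) = ρ * (|β1| + |β2|) := by field_simp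
      rw [this]
      nlinarith [abs_nonneg β1, abs_nonneg β2]
    · rw [h3, norm_zero]
      positivity
end

section
/- Fix a1, a2 > 0, real numbers δ1, δ2, and let q : [-1,1] → ℝ be continuous on [-1,0] and on [0,1]. For s ∈ ℂ with s ≠ 0 and λ = s⁴, let φ11(·,λ) be the unique solution of a1⁴u'''' + qu = λu on [-1,0] with φ11(-1) = 0, φ11'(-1) = 0, φ11''(-1) = 0, φ11'''(-1) = -1, and let φ12(·,λ) be the unique solution of a2⁴u'''' + qu = λu on [0,1] with initial data φ12(0) = φ11(0), φ12'(0) = φ11'(0), φ12''(0) = φ11''(0) − λδ1φ11'(0), φ12'''(0) = φ11'''(0) − λδ2φ11(0). Then there exist constants C > 0 and r₀ > 0 such that for all s ∈ ℂ with |s| ≥ r₀ and all x ∈ [0,1]: |φ12(x, s⁴)| ≤ C·|s|³·e^{|s|(a1·x + a2)/(a1·a2)}. -/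
open Set

/-- Growth of solutions of `a^4 u'''' + q u = s^4 u`: with `ω = |s| / a`, the rescaled derivatives
`u^(k) / ω^k` (`k < 4`) grow at most at the rate `ω + M / a`, where `M` bounds `|q|`. -/
lemma SolvesODE.norm_iteratedDerivWithin_le_s9 {a l r M B : ℝ} {q : ℝ → ℝ} {s : ℂ} {u : ℝ → ℂ}
    (ha : 0 < a) (hlr : l < r) (hs : 1 ≤ ‖s‖) (hq : ∀ x ∈ Icc l r, |q x| ≤ M)
    (hu : SolvesODE a q (s ^ 4) (Icc l r) u)
    (h₀ : ∀ k < 4, ‖iteratedDerivWithin k u (Icc l r) l‖ ≤ B * (‖s‖ / a) ^ k) :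
    ∀ x ∈ Icc l r, ∀ k < 4, ‖iteratedDerivWithin k u (Icc l r) x‖ ≤
      B * (‖s‖ / a) ^ k * Real.exp ((‖s‖ / a + M / a) * (x - l)) := by
  obtain ⟨hcd, hode⟩ := hu
  set ω := ‖s‖ / a with hω
  have hω0 : 0 < ω := by positivity
  have hM : 0 ≤ M := (abs_nonneg _).trans (hq l ⟨le_rfl, hlr.le⟩)
  have hB : 0 ≤ B := by simpa using (norm_nonneg _).trans (h₀ 0 (by norm_num))
  have hd : ∀ k < 4, ∀ x ∈ Icc l r, HasDerivWithinAt (iteratedDerivWithin k u (Icc l r))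
      (iteratedDerivWithin (k + 1) u (Icc l r) x) (Icc l r) x := by
    intro k hk x hx
    rw [iteratedDerivWithin_succ]
    exact ((hcd.differentiableOn_iteratedDerivWithin (by exact_mod_cast hk)
      (uniqueDiffOn_Icc hlr)) x hx).hasDerivWithinAt
  let U : ℝ → Fin 4 → ℂ := fun x k => iteratedDerivWithin k u (Icc l r) x / (ω : ℂ) ^ (k : ℕ)
  let U' : ℝ → Fin 4 → ℂ := fun x k =>
    iteratedDerivWithin (k + 1) u (Icc l r) x / (ω : ℂ) ^ (k : ℕ)
  have hU : ∀ x ∈ Icc l r, HasDerivWithinAt U (U' x) (Icc l r) x := fun x hx =>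
    hasDerivWithinAt_pi.2 fun k => (hd k k.2 x hx).div_const _
  have hnorm : ∀ x, ∀ k : Fin 4,
      ‖iteratedDerivWithin k u (Icc l r) x‖ / ω ^ (k : ℕ) ≤ ‖U x‖ := by
    intro x k
    simpa [U, abs_of_pos hω0] using norm_le_pi_norm (U x) k
  have hbound : ∀ x ∈ Ico l r, ‖U' x‖ ≤ (ω + M / a) * ‖U x‖ + 0 := by
    intro x hx
    have hx' := Ico_subset_Icc_self hx
    rw [add_zero]
    refine (pi_norm_le_iff_of_nonneg (by positivity)).2 fun k => ?_
    have hlow : ∀ j : ℕ, j + 1 < 4 →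
        ‖iteratedDerivWithin (j + 1) u (Icc l r) x‖ / ω ^ j ≤ (ω + M / a) * ‖U x‖ := by
      intro j hj
      have h := hnorm x ⟨j + 1, hj⟩
      calc ‖iteratedDerivWithin (j + 1) u (Icc l r) x‖ / ω ^ j
          = ω * (‖iteratedDerivWithin (j + 1) u (Icc l r) x‖ / ω ^ (j + 1)) := by
            rw [pow_succ]; field_simp
        _ ≤ ω * ‖U x‖ := by gcongr
        _ ≤ (ω + M / a) * ‖U x‖ := by
            gcongr
            exact le_add_of_nonneg_right (by positivity)
    have htop : ‖iteratedDerivWithin 4 u (Icc l r) x‖ / ω ^ 3 ≤ (ω + M / a) * ‖U x‖ := by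
      have h0 : ‖u x‖ ≤ ‖U x‖ := by simpa using hnorm x 0
      have ha4 : a ^ 4 * ‖iteratedDerivWithin 4 u (Icc l r) x‖ ≤ (‖s‖ ^ 4 + M) * ‖U x‖ := by
        have e : (a : ℂ) ^ 4 * iteratedDerivWithin 4 u (Icc l r) x = (s ^ 4 - q x) * u x := by
          linear_combination hode x hx'
        have e' := congrArg norm e
        rw [norm_mul, norm_mul, norm_pow, Complex.norm_real, Real.norm_eq_abs,
          abs_of_pos ha] at e'
        rw [e']
        gcongr
        refine (norm_sub_le _ _).trans ?_
        rw [norm_pow, Complex.norm_real, Real.norm_eq_abs]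
        gcongr
        exact hq x hx'
      have hs3 : 1 ≤ ‖s‖ ^ 3 := one_le_pow₀ hs
      have hs0 : 0 < ‖s‖ := by positivity
      calc ‖iteratedDerivWithin 4 u (Icc l r) x‖ / ω ^ 3
          = a ^ 4 * ‖iteratedDerivWithin 4 u (Icc l r) x‖ / (a * ‖s‖ ^ 3) := by
            rw [hω]; field_simp
        _ ≤ (‖s‖ ^ 4 + M) * ‖U x‖ / (a * ‖s‖ ^ 3) := by gcongr
        _ = (ω + M / (a * ‖s‖ ^ 3)) * ‖U x‖ := by rw [hω]; field_simp
        _ ≤ (ω + M / a) * ‖U x‖ := by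
            gcongr
            exact le_mul_of_one_le_right ha.le hs3
    have hk : ‖U' x k‖ = ‖iteratedDerivWithin (k + 1) u (Icc l r) x‖ / ω ^ (k : ℕ) := by
      simp [U', abs_of_pos hω0]
    rw [hk]
    rcases Nat.lt_or_ge ((k : ℕ) + 1) 4 with h | h
    · exact hlow k h
    · have hk3 : (k : ℕ) = 3 := by omega
      rw [hk3]
      exact htop
  have hinit : ‖U l‖ ≤ B := by
    refine (pi_norm_le_iff_of_nonneg hB).2 fun k => ?_
    have hk : ‖U l k‖ = ‖iteratedDerivWithin k u (Icc l r) l‖ / ω ^ (k : ℕ) := by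
      simp [U, abs_of_pos hω0]
    rw [hk, div_le_iff₀ (by positivity)]
    exact h₀ k k.2
  intro x hx k hk
  have hgr := norm_le_gronwallBound_of_norm_deriv_right_le
    (fun y hy => (hU y hy).continuousWithinAt)
    (fun y hy => (hU y (Ico_subset_Icc_self hy)).mono_of_mem_nhdsWithin
      (Icc_mem_nhdsGE_of_mem hy)) hinit hbound x hx
  rw [gronwallBound_ε0] at hgr
  have h := (hnorm x ⟨k, hk⟩).trans hgr
  rw [div_le_iff₀ (by positivity)] at h
  exact h.trans_eq (by ring)

/-- A continuous real function on a compact interval is bounded in absolute value. -/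
lemma ContinuousOn.exists_abs_le_Icc {q : ℝ → ℝ} {l r : ℝ} (hq : ContinuousOn q (Icc l r)) :
    ∃ M, ∀ x ∈ Icc l r, |q x| ≤ M :=
  isCompact_Icc.exists_bound_of_continuousOn hq

/-- Growth estimate for `φ12(·, s⁴)`, the continuation of `φ11` across `0` via the
transmission conditions, from the proof of Lemma 4.2. -/
theorem phi12_asymptotic_bound
    (a1 a2 δ1 δ2 : ℝ) (ha1 : 0 < a1) (ha2 : 0 < a2) (q : ℝ → ℝ)
    (hq1 : ContinuousOn q (Icc (-1 : ℝ) 0)) (hq2 : ContinuousOn q (Icc (0 : ℝ) 1)) :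
    ∃ C > (0 : ℝ), ∃ r₀ > (0 : ℝ), ∀ s : ℂ, r₀ ≤ ‖s‖ →
      ∀ φ11 φ12 : ℝ → ℂ,
        SolvesODE a1 q (s ^ 4) (Icc (-1 : ℝ) 0) φ11 →
        φ11 (-1) = 0 →
        iteratedDerivWithin 1 φ11 (Icc (-1 : ℝ) 0) (-1) = 0 →
        iteratedDerivWithin 2 φ11 (Icc (-1 : ℝ) 0) (-1) = 0 →
        iteratedDerivWithin 3 φ11 (Icc (-1 : ℝ) 0) (-1) = -1 →
        SolvesODE a2 q (s ^ 4) (Icc (0 : ℝ) 1) φ12 →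
        φ12 0 = φ11 0 →
        iteratedDerivWithin 1 φ12 (Icc (0 : ℝ) 1) 0
          = iteratedDerivWithin 1 φ11 (Icc (-1 : ℝ) 0) 0 →
        iteratedDerivWithin 2 φ12 (Icc (0 : ℝ) 1) 0
          = iteratedDerivWithin 2 φ11 (Icc (-1 : ℝ) 0) 0
            - s ^ 4 * (δ1 : ℂ) * iteratedDerivWithin 1 φ11 (Icc (-1 : ℝ) 0) 0 →
        iteratedDerivWithin 3 φ12 (Icc (0 : ℝ) 1) 0
          = iteratedDerivWithin 3 φ11 (Icc (-1 : ℝ) 0) 0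
            - s ^ 4 * (δ2 : ℂ) * φ11 0 →
        ∀ x ∈ Icc (0 : ℝ) 1,
          ‖φ12 x‖ ≤ C * ‖s‖ ^ 3 * Real.exp (‖s‖ * (a1 * x + a2) / (a1 * a2)) := by
  obtain ⟨M₁, hM₁⟩ := hq1.exists_abs_le_Icc
  obtain ⟨M₂, hM₂⟩ := hq2.exists_abs_le_Icc
  set D := a1 ^ 3 + a1 ^ 2 * a2 + (a1 + |δ1| * a1 ^ 2) * a2 ^ 2 + (1 + |δ2| * a1 ^ 3) * a2 ^ 3
    with hD
  have hD0 : 0 < D := by positivity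
  have hM₂0 : 0 ≤ M₂ := (abs_nonneg _).trans (hM₂ 0 (by simp))
  refine ⟨D * Real.exp (M₁ / a1 + M₂ / a2), by positivity, 1, one_pos, ?_⟩
  intro s hs φ11 φ12 h11 i0 i1 i2 i3 h12 j0 j1 j2 j3 x hx
  have hs0 : 0 < ‖s‖ := by positivity
  set E := Real.exp (‖s‖ / a1 + M₁ / a1) with hE
  have hE0 : 0 < E := Real.exp_pos _
  have hleft : ∀ k < 4, ‖iteratedDerivWithin k φ11 (Icc (-1 : ℝ) 0) 0‖ ≤ a1 ^ (3 - k) * E := by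
    intro k hk
    have h := h11.norm_iteratedDerivWithin_le_s9 (B := (a1 / ‖s‖) ^ 3) ha1 (by norm_num) hs hM₁
      (by
        intro k hk
        interval_cases k
        · simp only [iteratedDerivWithin_zero, i0, norm_zero]; positivity
        · rw [i1, norm_zero]; positivity
        · rw [i2, norm_zero]; positivity
        · rw [i3, norm_neg, norm_one]
          apply le_of_eq
          field_simp) 0 (by simp) k hk
    rw [show (‖s‖ / a1 + M₁ / a1) * (0 - -1) = ‖s‖ / a1 + M₁ / a1 by ring] at h
    refine h.trans ?_
    gcongr
    calc (a1 / ‖s‖) ^ 3 * (‖s‖ / a1) ^ k = a1 ^ (3 - k) / ‖s‖ ^ (3 - k) := by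
          obtain ⟨m, hm⟩ : ∃ m, 3 = m + k := ⟨3 - k, by omega⟩
          rw [hm, Nat.add_sub_cancel, pow_add]
          simp only [div_pow]
          field_simp
      _ ≤ a1 ^ (3 - k) := div_le_self (by positivity) (one_le_pow₀ hs)
  have k0 := hleft 0 (by norm_num)
  have k1 := hleft 1 (by norm_num)
  have k2 := hleft 2 (by norm_num)
  have k3 := hleft 3 (by norm_num)
  simp only [Nat.reduceSub, Nat.sub_zero, iteratedDerivWithin_zero, pow_zero, pow_one, one_mul]
    at k0 k1 k2 k3
  have hjump : ∀ (δ A B : ℝ) (v w : ℂ), ‖v‖ ≤ A → ‖w‖ ≤ B →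
      ‖v - s ^ 4 * (δ : ℂ) * w‖ ≤ A + ‖s‖ ^ 4 * |δ| * B := by
    intro δ A B v w hv hw
    refine (norm_sub_le _ _).trans ?_
    rw [norm_mul, norm_mul, norm_pow, Complex.norm_real, Real.norm_eq_abs]
    gcongr
  have hright : ∀ k < 4, ‖iteratedDerivWithin k φ12 (Icc (0 : ℝ) 1) 0‖ ≤
      D * E * ‖s‖ ^ 3 * (‖s‖ / a2) ^ k := by
    have key : ∀ (k : ℕ) (c : ℝ), 0 ≤ c → c * a2 ^ k ≤ D → ∀ p ≤ 3 + k,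
        c * E * ‖s‖ ^ p ≤ D * E * ‖s‖ ^ 3 * (‖s‖ / a2) ^ k := by
      intro k c hc hcD p hp
      calc c * E * ‖s‖ ^ p ≤ c * E * ‖s‖ ^ (3 + k) := by gcongr
        _ = c * a2 ^ k * E * ‖s‖ ^ 3 * (‖s‖ / a2) ^ k := by
          rw [pow_add, div_pow]; field_simp
        _ ≤ _ := by gcongr
    have hs4 : 1 ≤ ‖s‖ ^ 4 := one_le_pow₀ hs
    have p1 : 0 ≤ a1 ^ 3 := by positivity
    have p2 : 0 ≤ a1 ^ 2 * a2 := by positivity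
    have p3 : 0 ≤ (a1 + |δ1| * a1 ^ 2) * a2 ^ 2 := by positivity
    have p4 : 0 ≤ (1 + |δ2| * a1 ^ 3) * a2 ^ 3 := by positivity
    intro k hk
    interval_cases k
    · rw [iteratedDerivWithin_zero, j0]
      refine k0.trans (le_trans (le_of_eq ?_)
        (key 0 (a1 ^ 3) p1 (by rw [hD]; linarith) 0 (by norm_num)))
      ring
    · rw [j1]
      refine k1.trans (le_trans (le_of_eq ?_)
        (key 1 (a1 ^ 2) (by positivity) (by rw [hD]; linarith) 0 (by norm_num)))
      ring
    · rw [j2]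
      refine (hjump _ _ _ _ _ k2 k1).trans (le_trans ?_
        (key 2 (a1 + |δ1| * a1 ^ 2) (by positivity) (by rw [hD]; linarith) 4 (by norm_num)))
      have := mul_le_mul_of_nonneg_left hs4 (by positivity : 0 ≤ a1 * E)
      linarith
    · rw [j3]
      refine (hjump _ _ _ _ _ k3 k0).trans (le_trans ?_
        (key 3 (1 + |δ2| * a1 ^ 3) (by positivity) (by rw [hD]; linarith) 4 (by norm_num)))
      have := mul_le_mul_of_nonneg_left hs4 hE0.le
      linarith
  have h := h12.norm_iteratedDerivWithin_le_s9 ha2 one_pos hs hM₂ hright x hx 0 (by norm_num)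
  rw [iteratedDerivWithin_zero, pow_zero, mul_one, sub_zero] at h
  have hexp : E * Real.exp ((‖s‖ / a2 + M₂ / a2) * x) ≤
      Real.exp (M₁ / a1 + M₂ / a2) * Real.exp (‖s‖ * (a1 * x + a2) / (a1 * a2)) := by
    rw [hE, ← Real.exp_add, ← Real.exp_add, Real.exp_le_exp]
    have e : ‖s‖ * (a1 * x + a2) / (a1 * a2) = ‖s‖ / a2 * x + ‖s‖ / a1 := by field_simp
    have hx1 : M₂ / a2 * x ≤ M₂ / a2 := mul_le_of_le_one_right (by positivity) hx.2
    rw [e]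
    linarith
  calc ‖φ12 x‖ ≤ D * E * ‖s‖ ^ 3 * Real.exp ((‖s‖ / a2 + M₂ / a2) * x) := h
    _ = D * ‖s‖ ^ 3 * (E * Real.exp ((‖s‖ / a2 + M₂ / a2) * x)) := by ring
    _ ≤ D * ‖s‖ ^ 3 *
        (Real.exp (M₁ / a1 + M₂ / a2) * Real.exp (‖s‖ * (a1 * x + a2) / (a1 * a2))) := by gcongr
    _ = _ := by ring
end

section
/- Fix a2 > 0 and let q : [0,1] → ℝ be continuous. For s ∈ ℂ with s ≠ 0 and λ = s⁴, let χ12(·,λ) be the unique solution of a2⁴u'''' + qu = λu on [0,1] with χ12(1) = -1, χ12'(1) = 0, χ12''(1) = 0, χ12'''(1) = λ. Then for each k ∈ {0,1,2,3} there exist constants C > 0 and r₀ > 0 such that for all s ∈ ℂ with |s| ≥ r₀ and all x ∈ [0,1]: |∂ₓᵏ χ12(x, s⁴)| ≤ C·|s|^{k+1}·e^{|s|(1−x)/a2}. -/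
open Set

/-- Grönwall's inequality, run backwards from `1`, for the derivatives of a fourth order problem,
where the `k`-th derivative is measured in units of `r ^ k`. -/
theorem norm_iteratedDerivWithin_le_of_norm_iteratedDerivWithin_four_le
    {u : ℝ → ℂ} (hu : ContDiffOn ℝ 4 u (Icc (0 : ℝ) 1)) {r K M : ℝ} (hr : 0 < r) (hrK : r ≤ K)
    (hM : 0 ≤ M)
    (h4 : ∀ x ∈ Icc (0 : ℝ) 1,
      ‖iteratedDerivWithin 4 u (Icc (0 : ℝ) 1) x‖ ≤ r ^ 3 * K * ‖u x‖)
    (h1 : ∀ k ≤ 3, ‖iteratedDerivWithin k u (Icc (0 : ℝ) 1) 1‖ ≤ r ^ k * M)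
    {k : ℕ} (hk : k ≤ 3) {x : ℝ} (hx : x ∈ Icc (0 : ℝ) 1) :
    ‖iteratedDerivWithin k u (Icc (0 : ℝ) 1) x‖ ≤ r ^ k * (M * Real.exp (K * (1 - x))) := by
  set D : ℕ → ℝ → ℂ := fun k => iteratedDerivWithin k u (Icc (0 : ℝ) 1) with hD
  have hderiv : ∀ k ≤ 3, ∀ y ∈ Icc (0 : ℝ) 1,
      HasDerivWithinAt (D k) (D (k + 1) y) (Icc (0 : ℝ) 1) y := by
    intro k hk y hy
    have hlt : (k : WithTop ℕ∞) < 4 := by exact_mod_cast Nat.lt_succ_of_le hk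
    have h := (hu.differentiableOn_iteratedDerivWithin hlt
      (uniqueDiffOn_Icc zero_lt_one) y hy).hasDerivWithinAt
    simpa only [hD, iteratedDerivWithin_succ] using h
  have hmaps : MapsTo (fun t : ℝ => 1 - t) (Icc 0 1) (Icc 0 1) := by
    rintro t ⟨h0, h1⟩
    constructor <;> simp only <;> linarith
  let v : ℝ → Fin 4 → ℂ := fun t j => ((r ^ (j : ℕ))⁻¹ : ℝ) • D j (1 - t)
  let v' : ℝ → Fin 4 → ℂ := fun t j => ((r ^ (j : ℕ))⁻¹ : ℝ) • ((-1 : ℝ) • D (j + 1) (1 - t))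
  have hv : ∀ t ∈ Icc (0 : ℝ) 1, HasDerivWithinAt v (v' t) (Icc 0 1) t := by
    intro t ht
    refine hasDerivWithinAt_pi.2 fun j => ?_
    have h := (hderiv j (by omega) (1 - t) (hmaps ht)).scomp t
      ((hasDerivWithinAt_id t (Icc (0 : ℝ) 1)).const_sub 1) hmaps
    exact h.const_smul ((r ^ (j : ℕ))⁻¹ : ℝ)
  have hnorm : ∀ t (j : Fin 4), ‖v t j‖ = (r ^ (j : ℕ))⁻¹ * ‖D j (1 - t)‖ := by
    intro t j
    simp only [v, norm_smul, Real.norm_eq_abs]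
    rw [abs_of_pos (by positivity)]
  have hbound : ∀ t ∈ Ico (0 : ℝ) 1, ‖v' t‖ ≤ K * ‖v t‖ + 0 := by
    intro t ht
    have hK : 0 ≤ K := hr.le.trans hrK
    rw [add_zero]
    refine (pi_norm_le_iff_of_nonneg (by positivity)).2 fun j => ?_
    have hj : ‖v' t j‖ = (r ^ (j : ℕ))⁻¹ * ‖D (j + 1) (1 - t)‖ := by
      simp only [v', norm_smul, Real.norm_eq_abs, abs_neg, abs_one, one_mul]
      rw [abs_of_pos (by positivity)]
    rw [hj]
    rcases (Nat.lt_succ_iff_lt_or_eq.1 j.2 : (j : ℕ) < 3 ∨ (j : ℕ) = 3) with h3 | h3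
    · have hle := norm_le_pi_norm (v t) ⟨j + 1, by omega⟩
      rw [hnorm] at hle
      calc (r ^ (j : ℕ))⁻¹ * ‖D (j + 1) (1 - t)‖
          = r * ((r ^ ((j : ℕ) + 1))⁻¹ * ‖D (j + 1) (1 - t)‖) := by
            field_simp
            ring
        _ ≤ K * ‖v t‖ := mul_le_mul hrK hle (by positivity) hK
    · have hle := norm_le_pi_norm (v t) 0
      rw [hnorm] at hle
      have h := h4 (1 - t) (hmaps (Ico_subset_Icc_self ht))
      rw [h3]
      calc (r ^ 3)⁻¹ * ‖D (3 + 1) (1 - t)‖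
          ≤ (r ^ 3)⁻¹ * (r ^ 3 * K * ‖u (1 - t)‖) := by gcongr
        _ = K * ‖u (1 - t)‖ := by field_simp
        _ ≤ K * ‖v t‖ := by
            gcongr
            simpa [hD] using hle
  have hzero : ‖v 0‖ ≤ M := by
    refine (pi_norm_le_iff_of_nonneg hM).2 fun j => ?_
    rw [hnorm, sub_zero, inv_mul_le_iff₀ (by positivity)]
    exact h1 j (by omega)
  have hmain := norm_le_gronwallBound_of_norm_deriv_right_le
    (fun t ht => (hv t ht).continuousWithinAt)
    (fun t ht => (hv t (Ico_subset_Icc_self ht)).mono_of_mem_nhdsWithin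
      (Icc_mem_nhdsGE_of_mem ht)) hzero hbound (1 - x) (hmaps hx)
  rw [gronwallBound_ε0, sub_zero] at hmain
  have hle := (norm_le_pi_norm (v (1 - x)) ⟨k, by omega⟩).trans hmain
  rw [hnorm, sub_sub_cancel, inv_mul_le_iff₀ (by positivity)] at hle
  exact hle

/-- Part of Lemma 4.3: growth of `χ12(·, s⁴)` (the solution on `[0,1]` with
eigenparameter-dependent initial data `(-1,0,0,λ)` at `1`) and its first
three derivatives. -/
theorem chi12_asymptotic_bound
    (a2 : ℝ) (ha2 : 0 < a2) (q : ℝ → ℝ)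
    (hq : ContinuousOn q (Icc (0 : ℝ) 1)) :
    ∀ k : ℕ, k ≤ 3 →
      ∃ C > (0 : ℝ), ∃ r₀ > (0 : ℝ), ∀ s : ℂ, r₀ ≤ ‖s‖ →
        ∀ χ12 : ℝ → ℂ,
          SolvesODE a2 q (s ^ 4) (Icc (0 : ℝ) 1) χ12 →
          χ12 1 = -1 →
          iteratedDerivWithin 1 χ12 (Icc (0 : ℝ) 1) 1 = 0 →
          iteratedDerivWithin 2 χ12 (Icc (0 : ℝ) 1) 1 = 0 →
          iteratedDerivWithin 3 χ12 (Icc (0 : ℝ) 1) 1 = s ^ 4 →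
          ∀ x ∈ Icc (0 : ℝ) 1,
            ‖iteratedDerivWithin k χ12 (Icc (0 : ℝ) 1) x‖
              ≤ C * ‖s‖ ^ (k + 1) * Real.exp (‖s‖ * (1 - x) / a2) := by
  intro k hk
  obtain ⟨Q, hQ⟩ := isCompact_Icc.exists_bound_of_continuousOn hq
  have hQ0 : 0 ≤ Q := (norm_nonneg _).trans (hQ 0 (by simp))
  refine ⟨(1 + a2 ^ 3) * Real.exp (Q / a2 ^ 4) / a2 ^ k, by positivity, max 1 a2, by positivity, ?_⟩
  intro s hs u hu hu0 hu1 hu2 hu3 x hx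
  have hs1 : 1 ≤ ‖s‖ := (le_max_left _ _).trans hs
  have hr1 : 1 ≤ ‖s‖ / a2 := (one_le_div ha2).2 ((le_max_right _ _).trans hs)
  set r := ‖s‖ / a2 with hr
  have hr0 : 0 < r := by positivity
  have hsr : ‖s‖ = a2 * r := by rw [hr]; field_simp
  have h4 : ∀ y ∈ Icc (0 : ℝ) 1, ‖iteratedDerivWithin 4 u (Icc (0 : ℝ) 1) y‖
      ≤ r ^ 3 * (r + Q / a2 ^ 4) * ‖u y‖ := by
    intro y hy
    have heq : (a2 : ℂ) ^ 4 * iteratedDerivWithin 4 u (Icc (0 : ℝ) 1) y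
        = (s ^ 4 - (q y : ℂ)) * u y := by
      linear_combination hu.2 y hy
    have hn := congrArg norm heq
    rw [norm_mul, norm_mul, norm_pow, Complex.norm_real, Real.norm_of_nonneg ha2.le] at hn
    have hq' : ‖s ^ 4 - (q y : ℂ)‖ ≤ (a2 * r) ^ 4 + Q := by
      refine (norm_sub_le _ _).trans ?_
      rw [norm_pow, Complex.norm_real, hsr]
      gcongr
      exact hQ y hy
    have hr3 : 1 ≤ r ^ 3 := one_le_pow₀ hr1
    refine le_of_mul_le_mul_left ?_ (pow_pos ha2 4)
    rw [hn]
    calc ‖s ^ 4 - (q y : ℂ)‖ * ‖u y‖ ≤ ((a2 * r) ^ 4 + r ^ 3 * Q) * ‖u y‖ := by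
          gcongr
          exact hq'.trans (by nlinarith)
      _ = a2 ^ 4 * (r ^ 3 * (r + Q / a2 ^ 4) * ‖u y‖) := by field_simp
  have h1 : ∀ j ≤ 3, ‖iteratedDerivWithin j u (Icc (0 : ℝ) 1) 1‖
      ≤ r ^ j * ((1 + a2 ^ 3) * ‖s‖) := by
    intro j hj
    interval_cases j
    · have : 0 ≤ a2 ^ 3 * ‖s‖ := by positivity
      simp only [iteratedDerivWithin_zero, hu0, norm_neg, norm_one, pow_zero]
      linarith
    · rw [hu1, norm_zero]; positivity
    · rw [hu2, norm_zero]; positivity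
    · rw [hu3, norm_pow]
      calc ‖s‖ ^ 4 = r ^ 3 * (a2 ^ 3 * ‖s‖) := by rw [hsr]; ring
        _ ≤ r ^ 3 * ((1 + a2 ^ 3) * ‖s‖) := by gcongr; linarith
  have hK : r ≤ r + Q / a2 ^ 4 := le_add_of_nonneg_right (by positivity)
  refine (norm_iteratedDerivWithin_le_of_norm_iteratedDerivWithin_four_le hu.1 hr0 hK
    (by positivity) h4 h1 hk hx).trans ?_
  have hexp : Real.exp ((r + Q / a2 ^ 4) * (1 - x))
      ≤ Real.exp (Q / a2 ^ 4) * Real.exp (‖s‖ * (1 - x) / a2) := by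
    rw [← Real.exp_add, Real.exp_le_exp]
    have h : Q / a2 ^ 4 * (1 - x) ≤ Q / a2 ^ 4 :=
      mul_le_of_le_one_right (by positivity) (by linarith [hx.1])
    have h' : ‖s‖ * (1 - x) / a2 = r * (1 - x) := by rw [hr]; ring
    rw [h']
    linarith
  calc r ^ k * ((1 + a2 ^ 3) * ‖s‖ * Real.exp ((r + Q / a2 ^ 4) * (1 - x)))
      ≤ r ^ k * ((1 + a2 ^ 3) * ‖s‖ *
          (Real.exp (Q / a2 ^ 4) * Real.exp (‖s‖ * (1 - x) / a2))) := by gcongr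
    _ = (1 + a2 ^ 3) * Real.exp (Q / a2 ^ 4) / a2 ^ k * ‖s‖ ^ (k + 1)
          * Real.exp (‖s‖ * (1 - x) / a2) := by
        rw [hr, div_pow]; ring
end

section
/- Fix a1, a2 > 0, real numbers δ1, δ2, and let q : [-1,1] → ℝ be continuous on [-1,0] and on [0,1]. For s ∈ ℂ with s ≠ 0 and λ = s⁴, let χ22(·,λ) be the unique solution of a2⁴u'''' + qu = λu on [0,1] with χ22(1) = 0, χ22'(1) = -1, χ22''(1) = λ, χ22'''(1) = 0, and let χ21(·,λ) be the unique solution of a1⁴u'''' + qu = λu on [-1,0] with initial data χ21(0) = χ22(0), χ21'(0) = χ22'(0), χ21''(0) = χ22''(0) + λδ1χ22'(0), χ21'''(0) = χ22'''(0) + λδ2χ22(0). Then for each k ∈ {0,1,2,3} there exist constants C > 0 and r₀ > 0 such that for all s ∈ ℂ with |s| ≥ r₀ and all x ∈ [-1,0]: |∂ₓᵏ χ21(x, s⁴)| ≤ C·|s|^{k+5}·e^{|s|(a1 − a2·x)/(a1·a2)}. -/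
open Set

theorem hasDerivWithinAt_iteratedDerivWithin {u : ℝ → ℂ} {S : Set ℝ} {n : ℕ}
    (hS : UniqueDiffOn ℝ S) (hu : ContDiffOn ℝ n u S) {i : ℕ} (hi : i < n) {x : ℝ} (hx : x ∈ S) :
    HasDerivWithinAt (iteratedDerivWithin i u S) (iteratedDerivWithin (i + 1) u S x) S x := by
  rw [iteratedDerivWithin_succ]
  exact ((hu.differentiableOn_iteratedDerivWithin (by exact_mod_cast hi) hS) x hx).hasDerivWithinAt

/-- Grönwall estimate, backwards from the right endpoint, for the rescaled jet
`u⁽ⁱ⁾ / σⁱ` of a function with `|u⁗| ≤ (σ⁴ + M) |u|`. -/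
theorem norm_iteratedDerivWithin_le_exp_of_fourth_le {α β σ M B : ℝ} (hαβ : α < β)
    (hσ : 1 ≤ σ) (hM : 0 ≤ M) (hB : 0 ≤ B) {u : ℝ → ℂ} (hu : ContDiffOn ℝ 4 u (Icc α β))
    (h4 : ∀ x ∈ Icc α β,
      ‖iteratedDerivWithin 4 u (Icc α β) x‖ ≤ (σ ^ 4 + M) * ‖u x‖)
    (hβ : ∀ i < 4, ‖iteratedDerivWithin i u (Icc α β) β‖ ≤ B * σ ^ i)
    {i : ℕ} (hi : i < 4) {x : ℝ} (hx : x ∈ Icc α β) :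
    ‖iteratedDerivWithin i u (Icc α β) x‖ ≤ B * Real.exp ((σ + M) * (β - x)) * σ ^ i := by
  have hσ0 : 0 < σ := by linarith
  have hS : UniqueDiffOn ℝ (Icc α β) := uniqueDiffOn_Icc hαβ
  set D : ℕ → ℝ → ℂ := fun j => iteratedDerivWithin j u (Icc α β) with hD
  have hDσ (j : ℕ) (y : ℝ) : ‖(σ ^ j)⁻¹ • D j y‖ = ‖D j y‖ / σ ^ j := by
    rw [norm_smul, norm_inv, norm_pow, Real.norm_of_nonneg hσ0.le, inv_mul_eq_div]
  let V : ℝ → Fin 4 → ℂ := fun t j => (σ ^ (j : ℕ))⁻¹ • D j (β - t)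
  let V' : ℝ → Fin 4 → ℂ := fun t j => (σ ^ (j : ℕ))⁻¹ • (-D (j + 1) (β - t))
  have hmaps : MapsTo (fun t => β - t) (Icc 0 (β - α)) (Icc α β) :=
    fun t ht => ⟨by linarith [ht.2], by linarith [ht.1]⟩
  have hV : ∀ t ∈ Icc 0 (β - α), HasDerivWithinAt V (V' t) (Icc 0 (β - α)) t := by
    intro t ht
    refine hasDerivWithinAt_pi.2 fun j => ?_
    have h := (hasDerivWithinAt_iteratedDerivWithin (n := 4) hS hu j.2 (hmaps ht)).scomp t
      ((hasDerivAt_id t).const_sub β).hasDerivWithinAt hmaps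
    refine HasDerivWithinAt.fun_const_smul (f := fun y => D j (β - y)) _ ?_
    simpa [Function.comp_def, hD] using h
  have hbound : ∀ t ∈ Ico 0 (β - α), ‖V' t‖ ≤ (σ + M) * ‖V t‖ + 0 := by
    intro t ht
    rw [add_zero]
    have hnn : 0 ≤ (σ + M) * ‖V t‖ := by positivity
    have hcomp (j : ℕ) (hj : j < 4) : ‖D j (β - t)‖ ≤ ‖V t‖ * σ ^ j := by
      have h := norm_le_pi_norm (V t) ⟨j, hj⟩
      change ‖(σ ^ j)⁻¹ • D j (β - t)‖ ≤ _ at h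
      rwa [hDσ, div_le_iff₀ (by positivity)] at h
    refine (pi_norm_le_iff_of_nonneg hnn).2 fun j => ?_
    change ‖(σ ^ (j : ℕ))⁻¹ • (-D (j + 1) (β - t))‖ ≤ _
    rw [smul_neg, norm_neg, norm_smul, norm_inv, norm_pow, Real.norm_of_nonneg hσ0.le,
      inv_mul_eq_div, div_le_iff₀ (by positivity)]
    have hV0 := norm_nonneg (V t)
    have hj := j.2
    rcases Nat.lt_or_ge ((j : ℕ) + 1) 4 with hlt | hge
    · refine (hcomp _ hlt).trans ?_
      rw [pow_succ]
      have : 0 ≤ M * ‖V t‖ * σ ^ (j : ℕ) := by positivity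
      linarith
    · have hj3 : (j : ℕ) = 3 := by omega
      rw [hj3]
      have h0 := hcomp 0 (by norm_num)
      have hu0 : D 0 (β - t) = u (β - t) := by simp [hD]
      rw [hu0, pow_zero, mul_one] at h0
      refine (h4 _ (hmaps (Ico_subset_Icc_self ht))).trans ?_
      have h3 : 1 ≤ σ ^ 3 := one_le_pow₀ hσ
      calc (σ ^ 4 + M) * ‖u (β - t)‖ ≤ (σ ^ 4 + M * σ ^ 3) * ‖V t‖ := by
            gcongr
            exact le_mul_of_one_le_right hM h3
        _ = (σ + M) * ‖V t‖ * σ ^ 3 := by ring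
  have hinit : ‖V 0‖ ≤ B := by
    refine (pi_norm_le_iff_of_nonneg hB).2 fun j => ?_
    change ‖(σ ^ (j : ℕ))⁻¹ • D j (β - 0)‖ ≤ _
    rw [hDσ, div_le_iff₀ (by positivity), sub_zero]
    exact hβ j j.2
  have hgr := norm_le_gronwallBound_of_norm_deriv_right_le
    (fun t ht => (hV t ht).continuousWithinAt)
    (fun t ht => (hV t (Ico_subset_Icc_self ht)).mono_of_mem_nhdsWithin
      (Icc_mem_nhdsGE_of_mem ht)) hinit hbound (β - x)
    ⟨by linarith [hx.2], by linarith [hx.1]⟩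
  rw [gronwallBound_ε0, sub_zero] at hgr
  have h := (norm_le_pi_norm (V (β - x)) ⟨i, hi⟩).trans hgr
  change ‖(σ ^ i)⁻¹ • D i (β - (β - x))‖ ≤ _ at h
  rwa [hDσ, div_le_iff₀ (by positivity), sub_sub_cancel] at h

/-- Backward growth estimate for solutions on an interval of length one, uniform in the
spectral parameter. -/
theorem SolvesODE.norm_iteratedDerivWithin_le_s13 {a Q α β B : ℝ} {q : ℝ → ℝ} {s : ℂ} {u : ℝ → ℂ}
    (ha : 0 < a) (hαβ : α < β) (hlen : β - α ≤ 1) (hQ : ∀ x ∈ Icc α β, ‖q x‖ ≤ Q)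
    (hs : a ≤ ‖s‖) (hu : SolvesODE a q (s ^ 4) (Icc α β) u) (hB : 0 ≤ B)
    (hβ : ∀ i < 4, ‖iteratedDerivWithin i u (Icc α β) β‖ ≤ B * (‖s‖ / a) ^ i)
    {i : ℕ} (hi : i < 4) {x : ℝ} (hx : x ∈ Icc α β) :
    ‖iteratedDerivWithin i u (Icc α β) x‖ ≤
      B * Real.exp (Q / a ^ 4) * Real.exp (‖s‖ / a * (β - x)) * (‖s‖ / a) ^ i := by
  have hQ0 : 0 ≤ Q := (norm_nonneg _).trans (hQ x hx)
  have hM : 0 ≤ Q / a ^ 4 := by positivity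
  have h4 : ∀ y ∈ Icc α β, ‖iteratedDerivWithin 4 u (Icc α β) y‖ ≤
      ((‖s‖ / a) ^ 4 + Q / a ^ 4) * ‖u y‖ := by
    intro y hy
    have h : (a : ℂ) ^ 4 * iteratedDerivWithin 4 u (Icc α β) y = (s ^ 4 - (q y : ℂ)) * u y := by
      linear_combination hu.2 y hy
    have hn := congrArg norm h
    rw [norm_mul, norm_mul, norm_pow, Complex.norm_real, Real.norm_of_nonneg ha.le] at hn
    have hle : ‖s ^ 4 - (q y : ℂ)‖ ≤ ‖s‖ ^ 4 + Q := by
      refine (norm_sub_le _ _).trans ?_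
      rw [norm_pow, Complex.norm_real]
      linarith [hQ y hy]
    rw [div_pow, ← add_div, div_mul_eq_mul_div, le_div_iff₀ (by positivity), mul_comm, hn]
    gcongr
  refine (norm_iteratedDerivWithin_le_exp_of_fourth_le hαβ ((one_le_div ha).2 hs) hM hB hu.1 h4
    hβ hi hx).trans ?_
  rw [mul_assoc B (Real.exp _) (Real.exp _), ← Real.exp_add]
  gcongr
  have : Q / a ^ 4 * (β - x) ≤ Q / a ^ 4 := mul_le_of_le_one_right hM (by linarith [hx.1])
  linarith

/-- Lemma 4.3, part for `χ21`: growth of the continuation of `χ22` across `0`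
via the reversed transmission conditions, and of its first three derivatives. -/
theorem chi21_asymptotic_bound
    (a1 a2 δ1 δ2 : ℝ) (ha1 : 0 < a1) (ha2 : 0 < a2) (q : ℝ → ℝ)
    (hq1 : ContinuousOn q (Icc (-1 : ℝ) 0)) (hq2 : ContinuousOn q (Icc (0 : ℝ) 1)) :
    ∀ k : ℕ, k ≤ 3 →
      ∃ C > (0 : ℝ), ∃ r₀ > (0 : ℝ), ∀ s : ℂ, r₀ ≤ ‖s‖ →
        ∀ χ22 χ21 : ℝ → ℂ,
          SolvesODE a2 q (s ^ 4) (Icc (0 : ℝ) 1) χ22 →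
          χ22 1 = 0 →
          iteratedDerivWithin 1 χ22 (Icc (0 : ℝ) 1) 1 = -1 →
          iteratedDerivWithin 2 χ22 (Icc (0 : ℝ) 1) 1 = s ^ 4 →
          iteratedDerivWithin 3 χ22 (Icc (0 : ℝ) 1) 1 = 0 →
          SolvesODE a1 q (s ^ 4) (Icc (-1 : ℝ) 0) χ21 →
          χ21 0 = χ22 0 →
          iteratedDerivWithin 1 χ21 (Icc (-1 : ℝ) 0) 0
            = iteratedDerivWithin 1 χ22 (Icc (0 : ℝ) 1) 0 →
          iteratedDerivWithin 2 χ21 (Icc (-1 : ℝ) 0) 0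
            = iteratedDerivWithin 2 χ22 (Icc (0 : ℝ) 1) 0
              + s ^ 4 * (δ1 : ℂ) * iteratedDerivWithin 1 χ22 (Icc (0 : ℝ) 1) 0 →
          iteratedDerivWithin 3 χ21 (Icc (-1 : ℝ) 0) 0
            = iteratedDerivWithin 3 χ22 (Icc (0 : ℝ) 1) 0
              + s ^ 4 * (δ2 : ℂ) * χ22 0 →
          ∀ x ∈ Icc (-1 : ℝ) 0,
            ‖iteratedDerivWithin k χ21 (Icc (-1 : ℝ) 0) x‖
              ≤ C * ‖s‖ ^ (k + 5) * Real.exp (‖s‖ * (a1 - a2 * x) / (a1 * a2)) := by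
  intro k hk
  obtain ⟨Q1, hQ1⟩ := isCompact_Icc.exists_bound_of_continuousOn hq1
  obtain ⟨Q2, hQ2⟩ := isCompact_Icc.exists_bound_of_continuousOn hq2
  let G : ℝ := (a2 ^ 2 + a2) * Real.exp (Q2 / a2 ^ 4) * (1 + a2⁻¹) ^ 3
  let F : ℝ := (1 + |δ1| + |δ2|) * (1 + a1) ^ 3
  have hG : 0 < G := by positivity
  have hF : 0 < F := by positivity
  refine ⟨G * F * Real.exp (Q1 / a1 ^ 4) * (a1 ^ k)⁻¹, by positivity, 1 + a1 + a2,
    by positivity, ?_⟩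
  intro s hs χ22 χ21 h22 h220 h221 h222 h223 h21 h210 h211 h212 h213 x hx
  have hR1 : 1 ≤ ‖s‖ := by linarith
  have hRa1 : a1 ≤ ‖s‖ := by linarith
  have hRa2 : a2 ≤ ‖s‖ := by linarith
  have hns (n : ℕ) : ‖s ^ n‖ = ‖s‖ ^ n := norm_pow s n
  set R := ‖s‖ with hR
  have hR0 : 0 < R := by linarith
  have hχ22 : ∀ i < 4, ‖iteratedDerivWithin i χ22 (Icc (0 : ℝ) 1) 0‖
      ≤ G * Real.exp (R / a2) * R ^ (i + 2) := by
    intro i hi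
    have h := h22.norm_iteratedDerivWithin_le_s13 (B := (a2 ^ 2 + a2) * R ^ 2) (i := i) (x := 0)
      ha2 one_pos (by norm_num) hQ2 hRa2 (by positivity) (by
        intro j hj
        rw [← hR]
        interval_cases j
        · simp only [iteratedDerivWithin_zero, h220, norm_zero]
          positivity
        · rw [h221, norm_neg, norm_one]
          calc (1 : ℝ) ≤ R ^ 3 := one_le_pow₀ hR1
            _ ≤ R ^ 3 + a2 * R ^ 3 := le_add_of_nonneg_right (by positivity)
            _ = (a2 ^ 2 + a2) * R ^ 2 * (R / a2) ^ 1 := by field_simp; ring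
        · rw [h222, hns]
          calc R ^ 4 ≤ R ^ 4 + R ^ 4 / a2 := le_add_of_nonneg_right (by positivity)
            _ = (a2 ^ 2 + a2) * R ^ 2 * (R / a2) ^ 2 := by field_simp
        · rw [h223, norm_zero]
          positivity) hi (by norm_num)
    have hinv : a2⁻¹ ^ i ≤ (1 + a2⁻¹) ^ 3 := by
      have h0 : 0 < a2⁻¹ := by positivity
      calc a2⁻¹ ^ i ≤ (1 + a2⁻¹) ^ i := by gcongr; linarith
        _ ≤ (1 + a2⁻¹) ^ 3 := pow_le_pow_right₀ (by linarith) (by omega)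
    calc _ ≤ _ := h
      _ = (a2 ^ 2 + a2) * Real.exp (Q2 / a2 ^ 4) * a2⁻¹ ^ i * Real.exp (R / a2) * R ^ (i + 2) := by
          rw [← hR, sub_zero, mul_one, div_pow, inv_pow]
          ring
      _ ≤ _ := by
          gcongr
          exact mul_le_mul_of_nonneg_left hinv (by positivity)
  set E := G * Real.exp (R / a2) with hE
  have hE0 : 0 < E := by positivity
  have hmono {m n : ℕ} (hmn : m ≤ n) : R ^ m ≤ R ^ n := pow_le_pow_right₀ hR1 hmn
  have hδ : 1 ≤ 1 + |δ1| + |δ2| := by linarith [abs_nonneg δ1, abs_nonneg δ2]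
  have hχ21 : ∀ i < 4, ‖iteratedDerivWithin i χ21 (Icc (-1 : ℝ) 0) 0‖
      ≤ E * (1 + |δ1| + |δ2|) * R ^ (i + 5) := by
    have hjump {i j m : ℕ} (δ : ℝ) {v w : ℂ} (hδ' : 1 + |δ| ≤ 1 + |δ1| + |δ2|)
        (hv : ‖v‖ ≤ E * R ^ i) (hw : ‖w‖ ≤ E * R ^ j) (him : i ≤ m) (hjm : 4 + j ≤ m) :
        ‖v + s ^ 4 * (δ : ℂ) * w‖ ≤ E * (1 + |δ1| + |δ2|) * R ^ m := by
      calc ‖v + s ^ 4 * (δ : ℂ) * w‖ ≤ ‖v‖ + R ^ 4 * |δ| * ‖w‖ := by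
            refine (norm_add_le _ _).trans_eq ?_
            rw [norm_mul, norm_mul, hns, Complex.norm_real, Real.norm_eq_abs]
        _ ≤ E * R ^ i + R ^ 4 * |δ| * (E * R ^ j) := by gcongr
        _ = E * R ^ i + E * |δ| * R ^ (4 + j) := by ring
        _ ≤ E * R ^ m + E * |δ| * R ^ m := by gcongr
        _ = E * (1 + |δ|) * R ^ m := by ring
        _ ≤ _ := by gcongr
    have h0 := hχ22 0 (by norm_num)
    have h1 := hχ22 1 (by norm_num)
    have h2 := hχ22 2 (by norm_num)
    have h3 := hχ22 3 (by norm_num)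
    have hz {v : ℂ} {i m : ℕ} (hv : ‖v‖ ≤ E * R ^ i) (him : i ≤ m) :
        ‖v‖ ≤ E * (1 + |δ1| + |δ2|) * R ^ m :=
      hv.trans (mul_le_mul (le_mul_of_one_le_right hE0.le hδ) (hmono him)
        (by positivity) (by positivity))
    rw [iteratedDerivWithin_zero] at h0
    intro i hi
    interval_cases i
    · rw [iteratedDerivWithin_zero, h210]
      exact hz h0 (by norm_num)
    · rw [h211]
      exact hz h1 (by norm_num)
    · rw [h212]
      exact hjump δ1 (by linarith [abs_nonneg δ2]) h2 h1 (by norm_num) (by norm_num)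
    · rw [h213]
      exact hjump δ2 (by linarith [abs_nonneg δ1]) h3 h0 (by norm_num) (by norm_num)
  have h := h21.norm_iteratedDerivWithin_le_s13 (B := E * F * R ^ 5) (i := k) (x := x)
    ha1 (by norm_num) (by norm_num) hQ1 hRa1 (by positivity) (by
      intro j hj
      rw [← hR]
      refine (hχ21 j hj).trans ?_
      have ha : a1 ^ j ≤ (1 + a1) ^ 3 := by
        calc a1 ^ j ≤ (1 + a1) ^ j := by gcongr; linarith
          _ ≤ (1 + a1) ^ 3 := pow_le_pow_right₀ (by linarith) (by omega)
      have hσ : R ^ j ≤ (1 + a1) ^ 3 * (R / a1) ^ j := by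
        calc R ^ j = a1 ^ j * (R / a1) ^ j := by rw [← mul_pow, mul_div_cancel₀ _ ha1.ne']
          _ ≤ _ := by gcongr
      calc E * (1 + |δ1| + |δ2|) * R ^ (j + 5)
          = E * (1 + |δ1| + |δ2|) * R ^ 5 * R ^ j := by ring
        _ ≤ E * (1 + |δ1| + |δ2|) * R ^ 5 * ((1 + a1) ^ 3 * (R / a1) ^ j) := by gcongr
        _ = E * F * R ^ 5 * (R / a1) ^ j := by ring) (by omega) hx
  refine h.trans_eq ?_
  have hexp : Real.exp (R * (a1 - a2 * x) / (a1 * a2))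
      = Real.exp (R / a2) * Real.exp (R / a1 * (0 - x)) := by
    rw [← Real.exp_add]
    congr 1
    field_simp
    ring
  rw [hexp, hE, ← hR, div_pow]
  ring
end

section
/- There exist constants C > 0 and r₀ > 0 such that for all s ∈ ℂ with |s| ≥ r₀: |W(s⁴)| ≤ C·|s|¹¹·e^{2|s|(a1 + a2)/(a1·a2)}. -/
open Set

/-- The derivatives of order at most three of `u` at `x`, taken within `S`, are bounded by
`M * t ^ k`. -/
def JetBound (S : Set ℝ) (u : ℝ → ℂ) (x t M : ℝ) : Prop :=
  ∀ k < 4, ‖iteratedDerivWithin k u S x‖ ≤ M * t ^ k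

theorem Matrix.norm_det_le_of_norm_entry_le {n : Type*} [Fintype n] [DecidableEq n]
    (A : Matrix n n ℂ) (r c : n → ℝ) (h : ∀ i j, ‖A i j‖ ≤ r i * c j) :
    ‖A.det‖ ≤ (Fintype.card n).factorial * ((∏ i, r i) * ∏ j, c j) := by
  rw [Matrix.det_apply]
  refine (norm_sum_le _ _).trans ?_
  have hterm : ∀ τ ∈ (Finset.univ : Finset (Equiv.Perm n)),
      ‖Equiv.Perm.sign τ • ∏ i, A (τ i) i‖ ≤ (∏ i, r i) * ∏ j, c j := by
    intro τ _
    have hs : ‖Equiv.Perm.sign τ • ∏ i, A (τ i) i‖ = ∏ i, ‖A (τ i) i‖ := by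
      rcases Int.units_eq_one_or (Equiv.Perm.sign τ) with h1 | h1 <;> simp [h1]
    rw [hs, ← Equiv.prod_comp τ r, ← Finset.prod_mul_distrib]
    exact Finset.prod_le_prod (fun _ _ => norm_nonneg _) fun i _ => h _ _
  refine (Finset.sum_le_sum hterm).trans ?_
  simp [Fintype.card_perm]

theorem norm_le_mul_exp_of_norm_deriv_le_left {E : Type*} [NormedAddCommGroup E]
    [NormedSpace ℝ E] {f f' : ℝ → E} {c d K : ℝ}
    (hf : ∀ x ∈ Icc c d, HasDerivWithinAt f (f' x) (Icc c d) x)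
    (hK : ∀ x ∈ Icc c d, ‖f' x‖ ≤ K * ‖f x‖) :
    ∀ x ∈ Icc c d, ‖f x‖ ≤ ‖f c‖ * Real.exp (K * (x - c)) := by
  intro x hx
  have := norm_le_gronwallBound_of_norm_deriv_right_le (f := f) (f' := f') (δ := ‖f c‖)
    (K := K) (ε := 0) (a := c) (b := d) (fun y hy => (hf y hy).continuousWithinAt)
    (fun y hy => (hf y (Ico_subset_Icc_self hy)).mono_of_mem_nhdsWithin
      (Icc_mem_nhdsGE_of_mem hy)) le_rfl
    (fun y hy => by simpa using hK y (Ico_subset_Icc_self hy)) x hx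
  simpa [gronwallBound_ε0] using this

theorem norm_le_mul_exp_of_norm_deriv_le_right {E : Type*} [NormedAddCommGroup E]
    [NormedSpace ℝ E] {f f' : ℝ → E} {c d K : ℝ}
    (hf : ∀ x ∈ Icc c d, HasDerivWithinAt f (f' x) (Icc c d) x)
    (hK : ∀ x ∈ Icc c d, ‖f' x‖ ≤ K * ‖f x‖) :
    ∀ x ∈ Icc c d, ‖f x‖ ≤ ‖f d‖ * Real.exp (K * (d - x)) := by
  intro x hx
  have hmaps : MapsTo (fun y : ℝ => -y) (Icc (-d) (-c)) (Icc c d) := fun y hy =>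
    ⟨by linarith [hy.2], by linarith [hy.1]⟩
  have := norm_le_mul_exp_of_norm_deriv_le_left (f := fun y => f (-y))
    (f' := fun y => (-1 : ℝ) • f' (-y)) (c := -d) (d := -c) (K := K)
    (fun y hy => (hf (-y) (hmaps hy)).scomp y (hasDerivAt_neg y).hasDerivWithinAt hmaps)
    (fun y hy => by simpa using hK (-y) (hmaps hy)) (-x) ⟨by linarith [hx.2], by linarith [hx.1]⟩
  simpa [add_comm, sub_eq_add_neg] using this

/-- The vector of derivatives of `u` rescaled by powers of `σ`. -/
noncomputable def scaledJet (S : Set ℝ) (u : ℝ → ℂ) (σ : ℝ) (x : ℝ) (k : Fin 4) : ℂ :=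
  iteratedDerivWithin k u S x / (σ : ℂ) ^ (k : ℕ)

theorem norm_scaledJet_le_iff {S : Set ℝ} {u : ℝ → ℂ} {σ x M : ℝ} (hσ : 0 < σ) (hM : 0 ≤ M) :
    ‖scaledJet S u σ x‖ ≤ M ↔ JetBound S u x σ M := by
  rw [pi_norm_le_iff_of_nonneg hM]
  have key : ∀ k : Fin 4, ‖scaledJet S u σ x k‖ ≤ M ↔
      ‖iteratedDerivWithin k u S x‖ ≤ M * σ ^ (k : ℕ) := fun k => by
    rw [scaledJet, norm_div, norm_pow, Complex.norm_real, Real.norm_of_nonneg hσ.le,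
      div_le_iff₀ (by positivity)]
  simp only [key]
  exact ⟨fun h k hk => h ⟨k, hk⟩, fun h k => h k k.2⟩

theorem hasDerivWithinAt_scaledJet {c d : ℝ} (hcd : c < d) {u : ℝ → ℂ}
    (hu : ContDiffOn ℝ 4 u (Icc c d)) (σ : ℝ) {x : ℝ} (hx : x ∈ Icc c d) :
    HasDerivWithinAt (scaledJet (Icc c d) u σ)
      (fun k : Fin 4 => iteratedDerivWithin (k + 1) u (Icc c d) x / (σ : ℂ) ^ (k : ℕ))
      (Icc c d) x := by
  rw [hasDerivWithinAt_pi]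
  intro k
  have hk : ((k : ℕ) : WithTop ℕ∞) < 4 := by exact_mod_cast k.2
  have h := (hu.differentiableOn_iteratedDerivWithin hk (uniqueDiffOn_Icc hcd) x
    hx).hasDerivWithinAt
  rw [← iteratedDerivWithin_succ] at h
  exact h.div_const _

theorem norm_deriv_scaledJet_le {a Q : ℝ} {q : ℝ → ℝ} (ha : 0 < a) {S : Set ℝ}
    {s : ℂ} (hs : 1 ≤ ‖s‖) {u : ℝ → ℂ} (hu : SolvesODE a q (s ^ 4) S u) {x : ℝ} (hx : x ∈ S)
    (hQ : |q x| ≤ Q) :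
    ‖fun k : Fin 4 => iteratedDerivWithin (k + 1) u S x / ((‖s‖ / a : ℝ) : ℂ) ^ (k : ℕ)‖
      ≤ (‖s‖ / a + Q / a) * ‖scaledJet S u (‖s‖ / a) x‖ := by
  have hs0 : 0 < ‖s‖ := one_pos.trans_le hs
  have hQ0 : 0 ≤ Q := (abs_nonneg _).trans hQ
  set σ := ‖s‖ / a with hσdef
  have hσ : 0 < σ := by positivity
  set N := ‖scaledJet S u σ x‖ with hN
  have hN0 : 0 ≤ N := norm_nonneg _
  have hjet : JetBound S u x σ N := (norm_scaledJet_le_iff hσ hN0).1 le_rfl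
  have hQa : 0 ≤ Q / a := by positivity
  rw [pi_norm_le_iff_of_nonneg (by positivity)]
  intro k
  rw [norm_div, norm_pow, Complex.norm_real, Real.norm_of_nonneg hσ.le,
    div_le_iff₀ (by positivity)]
  have hlow : ∀ j < 3, ‖iteratedDerivWithin (j + 1) u S x‖ ≤ (σ + Q / a) * N * σ ^ j := by
    intro j hj
    calc _ ≤ N * σ ^ (j + 1) := hjet (j + 1) (by omega)
      _ = σ * N * σ ^ j := by ring
      _ ≤ _ := by gcongr; linarith
  have htop : ‖iteratedDerivWithin 4 u S x‖ ≤ (σ + Q / a) * N * σ ^ 3 := by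
    have heq : (a : ℂ) ^ 4 * iteratedDerivWithin 4 u S x = (s ^ 4 - q x) * u x := by
      linear_combination hu.2 x hx
    have h0 : ‖u x‖ ≤ N := by simpa using hjet 0 (by norm_num)
    have hle : a ^ 4 * ‖iteratedDerivWithin 4 u S x‖ ≤ (‖s‖ ^ 4 + Q) * N := by
      calc a ^ 4 * ‖iteratedDerivWithin 4 u S x‖ = ‖(s ^ 4 - q x) * u x‖ := by
            rw [← heq, norm_mul, norm_pow, Complex.norm_real, Real.norm_of_nonneg ha.le]
        _ ≤ (‖s‖ ^ 4 + Q) * N := by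
            rw [norm_mul]
            gcongr
            refine (norm_sub_le _ _).trans ?_
            rw [norm_pow, Complex.norm_real]
            gcongr
            exact hQ
    have hs3 : 1 ≤ ‖s‖ ^ 3 := one_le_pow₀ hs
    refine le_of_mul_le_mul_left (hle.trans ?_) (show 0 < a ^ 4 by positivity)
    calc (‖s‖ ^ 4 + Q) * N ≤ (‖s‖ ^ 4 + Q * ‖s‖ ^ 3) * N := by
          gcongr
          exact le_mul_of_one_le_right hQ0 hs3
      _ = a ^ 4 * ((σ + Q / a) * N * σ ^ 3) := by
          rw [hσdef]
          field_simp
  rcases Nat.lt_succ_iff_lt_or_eq.1 k.2 with hk | hk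
  · exact hlow k hk
  · rw [hk]
    exact htop

theorem JetBound.mul_left {S : Set ℝ} {u : ℝ → ℂ} {x t b M : ℝ} (hb : 0 < b) (ht : 0 ≤ t)
    (hM : 0 ≤ M) (h : JetBound S u x t M) :
    JetBound S u x (b * t) ((max 1 b⁻¹) ^ 3 * M) := by
  intro k hk
  have hpow : 1 ≤ (max 1 b⁻¹) ^ 3 * b ^ k := by
    calc (1 : ℝ) = b⁻¹ ^ k * b ^ k := by rw [← mul_pow, inv_mul_cancel₀ hb.ne', one_pow]
      _ ≤ (max 1 b⁻¹) ^ k * b ^ k := by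
          gcongr
          exact le_max_right _ _
      _ ≤ (max 1 b⁻¹) ^ 3 * b ^ k := by
          gcongr
          · exact le_max_left _ _
          · omega
  calc _ ≤ M * t ^ k := h k hk
    _ ≤ (M * t ^ k) * ((max 1 b⁻¹) ^ 3 * b ^ k) := le_mul_of_one_le_right (by positivity) hpow
    _ = _ := by ring

/-- Solutions of the fourth order equation grow at most like `exp (‖s‖ / a * |x - x₀|)` away from
either endpoint `x₀` of the interval, uniformly in large `s`. -/
theorem exists_jetBound_of_solvesODE {a c d : ℝ} {q : ℝ → ℝ} (ha : 0 < a) (hcd : c < d)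
    (hq : ContinuousOn q (Icc c d)) :
    ∃ D > (0 : ℝ), ∀ s : ℂ, 1 ≤ ‖s‖ → ∀ u : ℝ → ℂ, SolvesODE a q (s ^ 4) (Icc c d) u →
      ∀ M : ℝ, 0 ≤ M → ∀ x ∈ Icc c d,
        (JetBound (Icc c d) u c ‖s‖ M →
          JetBound (Icc c d) u x ‖s‖ (D * M * Real.exp (‖s‖ / a * (x - c)))) ∧
        (JetBound (Icc c d) u d ‖s‖ M →
          JetBound (Icc c d) u x ‖s‖ (D * M * Real.exp (‖s‖ / a * (d - x)))) := by
  obtain ⟨Q, hQ⟩ := isCompact_Icc.exists_bound_of_continuousOn hq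
  have hQ0 : 0 ≤ Q := (norm_nonneg _).trans (hQ c (left_mem_Icc.2 hcd.le))
  set A := (max 1 a) ^ 3 with hA
  set B := (max 1 a⁻¹) ^ 3 with hB
  have hA0 : 0 < A := by positivity
  have hB0 : 0 < B := by positivity
  refine ⟨A * B * Real.exp (Q / a * (d - c)), by positivity, ?_⟩
  intro s hs u hu M hM x hx
  have hs0 : 0 < ‖s‖ := one_pos.trans_le hs
  have hσ : 0 < ‖s‖ / a := by positivity
  have hder := fun y (hy : y ∈ Icc c d) => hasDerivWithinAt_scaledJet hcd hu.1 (‖s‖ / a) hy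
  have hnorm := fun y (hy : y ∈ Icc c d) => norm_deriv_scaledJet_le ha hs hu hy (hQ y hy)
  have hstep : ∀ y l : ℝ, 0 ≤ l → l ≤ d - c → JetBound (Icc c d) u y ‖s‖ M →
      ‖scaledJet (Icc c d) u (‖s‖ / a) x‖ ≤
        ‖scaledJet (Icc c d) u (‖s‖ / a) y‖ * Real.exp ((‖s‖ / a + Q / a) * l) →
      JetBound (Icc c d) u x ‖s‖
        (A * B * Real.exp (Q / a * (d - c)) * M * Real.exp (‖s‖ / a * l)) := by
    intro y l hl hld hy hxy
    have h1 : JetBound (Icc c d) u y (‖s‖ / a) (A * M) := by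
      have := hy.mul_left (inv_pos.2 ha) hs0.le hM
      rwa [inv_inv, inv_mul_eq_div] at this
    rw [← norm_scaledJet_le_iff hσ (by positivity)] at h1
    have h2 : ‖scaledJet (Icc c d) u (‖s‖ / a) x‖ ≤
        A * M * (Real.exp (Q / a * (d - c)) * Real.exp (‖s‖ / a * l)) := by
      refine hxy.trans ?_
      rw [← Real.exp_add]
      gcongr
      have : Q / a * l ≤ Q / a * (d - c) := by gcongr
      linarith
    rw [norm_scaledJet_le_iff hσ (by positivity)] at h2
    have h3 := h2.mul_left ha hσ.le (by positivity)
    rw [mul_div_cancel₀ _ ha.ne'] at h3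
    convert h3 using 1
    ring
  exact ⟨fun h => hstep c (x - c) (by linarith [hx.1]) (by linarith [hx.2]) h
      (norm_le_mul_exp_of_norm_deriv_le_left hder hnorm x hx),
    fun h => hstep d (d - x) (by linarith [hx.2]) (by linarith [hx.1]) h
      (norm_le_mul_exp_of_norm_deriv_le_right hder hnorm x hx)⟩

theorem jetBound_of_forall {S : Set ℝ} {u : ℝ → ℂ} {x t M : ℝ}
    (h0 : ‖u x‖ ≤ M) (h1 : ‖iteratedDerivWithin 1 u S x‖ ≤ M * t)
    (h2 : ‖iteratedDerivWithin 2 u S x‖ ≤ M * t ^ 2)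
    (h3 : ‖iteratedDerivWithin 3 u S x‖ ≤ M * t ^ 3) : JetBound S u x t M := by
  intro k hk
  interval_cases k
  · simpa using h0
  · simpa using h1
  · exact h2
  · exact h3

theorem JetBound.transmission {S T : Set ℝ} {u v : ℝ → ℂ} {x M δ1 δ2 : ℝ} {s : ℂ}
    (hs : 1 ≤ ‖s‖) (hM : 0 ≤ M) (hv : JetBound T v x ‖s‖ M)
    (h : u x = v x ∧ iteratedDerivWithin 1 u S x = iteratedDerivWithin 1 v T x ∧
      iteratedDerivWithin 2 u S x = iteratedDerivWithin 2 v T x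
        + s ^ 4 * (δ1 : ℂ) * iteratedDerivWithin 1 v T x ∧
      iteratedDerivWithin 3 u S x = iteratedDerivWithin 3 v T x + s ^ 4 * (δ2 : ℂ) * v x) :
    JetBound S u x ‖s‖ ((1 + |δ1| + |δ2|) * M * ‖s‖ ^ 3) := by
  obtain ⟨e0, e1, e2, e3⟩ := h
  have b0 : ‖v x‖ ≤ M := by simpa using hv 0 (by norm_num)
  have b1 : ‖iteratedDerivWithin 1 v T x‖ ≤ M * ‖s‖ := by simpa using hv 1 (by norm_num)
  have b2 := hv 2 (by norm_num)
  have b3 := hv 3 (by norm_num)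
  have hp3 : 1 ≤ ‖s‖ ^ 3 := one_le_pow₀ hs
  have hp46 : ‖s‖ ^ 4 ≤ ‖s‖ ^ 6 := pow_le_pow_right₀ hs (by norm_num)
  have hδ1 := abs_nonneg δ1
  have hδ2 := abs_nonneg δ2
  have hMle : M ≤ (1 + |δ1| + |δ2|) * M * ‖s‖ ^ 3 :=
    calc M = 1 * M * 1 := by ring
      _ ≤ _ := by gcongr; linarith
  refine jetBound_of_forall ?_ ?_ ?_ ?_
  · rw [e0]
    exact b0.trans hMle
  · rw [e1]
    exact b1.trans (by gcongr)
  · rw [e2]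
    calc _ ≤ M * ‖s‖ ^ 2 + ‖s‖ ^ 4 * |δ1| * (M * ‖s‖) := by
          refine (norm_add_le _ _).trans ?_
          rw [norm_mul, norm_mul, norm_pow, Complex.norm_real, Real.norm_eq_abs]
          gcongr
      _ = 1 * M * 1 * ‖s‖ ^ 2 + |δ1| * M * ‖s‖ ^ 3 * ‖s‖ ^ 2 := by ring
      _ ≤ (1 + |δ2|) * M * ‖s‖ ^ 3 * ‖s‖ ^ 2 + |δ1| * M * ‖s‖ ^ 3 * ‖s‖ ^ 2 := by
          gcongr
          linarith
      _ = _ := by ring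
  · rw [e3]
    calc _ ≤ M * ‖s‖ ^ 3 + ‖s‖ ^ 4 * |δ2| * M := by
          refine (norm_add_le _ _).trans ?_
          rw [norm_mul, norm_mul, norm_pow, Complex.norm_real, Real.norm_eq_abs]
          gcongr
      _ = 1 * M * 1 * ‖s‖ ^ 3 + |δ2| * M * ‖s‖ ^ 4 := by ring
      _ ≤ (1 + |δ1|) * M * ‖s‖ ^ 3 * ‖s‖ ^ 3 + |δ2| * M * ‖s‖ ^ 6 := by
          gcongr
          linarith
      _ = _ := by ring

/-- Theorem 4.4: asymptotic bound `|W(s⁴)| ≤ C |s|¹¹ e^{2|s|(a1+a2)/(a1 a2)}` for the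
characteristic function, the Wronskian of the fundamental solutions
`φ11, φ21, χ11, χ21` (evaluated anywhere in `[-1,0]`). -/
theorem charFunction_asymptotic_bound
    (a1 a2 β1 β2 δ1 δ2 : ℝ) (ha1 : 0 < a1) (ha2 : 0 < a2)
    (hβ : |β1| + |β2| ≠ 0) (hδ : |δ1| + |δ2| ≠ 0) (q : ℝ → ℝ)
    (hq1 : ContinuousOn q (Icc (-1 : ℝ) 0)) (hq2 : ContinuousOn q (Icc (0 : ℝ) 1)) :
    ∃ C > (0 : ℝ), ∃ r₀ > (0 : ℝ), ∀ s : ℂ, r₀ ≤ ‖s‖ →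
      ∀ φ11 φ21 χ12 χ22 χ11 χ21 : ℝ → ℂ,
        SolvesODE a1 q (s ^ 4) (Icc (-1 : ℝ) 0) φ11 →
        (φ11 (-1) = 0 ∧ iteratedDerivWithin 1 φ11 (Icc (-1 : ℝ) 0) (-1) = 0 ∧
          iteratedDerivWithin 2 φ11 (Icc (-1 : ℝ) 0) (-1) = 0 ∧
          iteratedDerivWithin 3 φ11 (Icc (-1 : ℝ) 0) (-1) = -1) →
        SolvesODE a1 q (s ^ 4) (Icc (-1 : ℝ) 0) φ21 →
        (φ21 (-1) = 0 ∧ iteratedDerivWithin 1 φ21 (Icc (-1 : ℝ) 0) (-1) = (β2 : ℂ) ∧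
          iteratedDerivWithin 2 φ21 (Icc (-1 : ℝ) 0) (-1) = -(β1 : ℂ) ∧
          iteratedDerivWithin 3 φ21 (Icc (-1 : ℝ) 0) (-1) = 0) →
        SolvesODE a2 q (s ^ 4) (Icc (0 : ℝ) 1) χ12 →
        (χ12 1 = -1 ∧ iteratedDerivWithin 1 χ12 (Icc (0 : ℝ) 1) 1 = 0 ∧
          iteratedDerivWithin 2 χ12 (Icc (0 : ℝ) 1) 1 = 0 ∧
          iteratedDerivWithin 3 χ12 (Icc (0 : ℝ) 1) 1 = s ^ 4) →
        SolvesODE a2 q (s ^ 4) (Icc (0 : ℝ) 1) χ22 →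
        (χ22 1 = 0 ∧ iteratedDerivWithin 1 χ22 (Icc (0 : ℝ) 1) 1 = -1 ∧
          iteratedDerivWithin 2 χ22 (Icc (0 : ℝ) 1) 1 = s ^ 4 ∧
          iteratedDerivWithin 3 χ22 (Icc (0 : ℝ) 1) 1 = 0) →
        SolvesODE a1 q (s ^ 4) (Icc (-1 : ℝ) 0) χ11 →
        (χ11 0 = χ12 0 ∧
          iteratedDerivWithin 1 χ11 (Icc (-1 : ℝ) 0) 0
            = iteratedDerivWithin 1 χ12 (Icc (0 : ℝ) 1) 0 ∧
          iteratedDerivWithin 2 χ11 (Icc (-1 : ℝ) 0) 0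
            = iteratedDerivWithin 2 χ12 (Icc (0 : ℝ) 1) 0
              + s ^ 4 * (δ1 : ℂ) * iteratedDerivWithin 1 χ12 (Icc (0 : ℝ) 1) 0 ∧
          iteratedDerivWithin 3 χ11 (Icc (-1 : ℝ) 0) 0
            = iteratedDerivWithin 3 χ12 (Icc (0 : ℝ) 1) 0
              + s ^ 4 * (δ2 : ℂ) * χ12 0) →
        SolvesODE a1 q (s ^ 4) (Icc (-1 : ℝ) 0) χ21 →
        (χ21 0 = χ22 0 ∧
          iteratedDerivWithin 1 χ21 (Icc (-1 : ℝ) 0) 0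
            = iteratedDerivWithin 1 χ22 (Icc (0 : ℝ) 1) 0 ∧
          iteratedDerivWithin 2 χ21 (Icc (-1 : ℝ) 0) 0
            = iteratedDerivWithin 2 χ22 (Icc (0 : ℝ) 1) 0
              + s ^ 4 * (δ1 : ℂ) * iteratedDerivWithin 1 χ22 (Icc (0 : ℝ) 1) 0 ∧
          iteratedDerivWithin 3 χ21 (Icc (-1 : ℝ) 0) 0
            = iteratedDerivWithin 3 χ22 (Icc (0 : ℝ) 1) 0
              + s ^ 4 * (δ2 : ℂ) * χ22 0) →
        ∀ x ∈ Icc (-1 : ℝ) 0,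
          ‖Matrix.det (Matrix.of fun i j : Fin 4 =>
              iteratedDerivWithin (i : ℕ) (![φ11, φ21, χ11, χ21] j) (Icc (-1 : ℝ) 0) x)‖
            ≤ C * ‖s‖ ^ 11 * Real.exp (2 * ‖s‖ * (a1 + a2) / (a1 * a2)) := by
  obtain ⟨D, hD, hleft⟩ := exists_jetBound_of_solvesODE ha1 (show (-1 : ℝ) < 0 by norm_num) hq1
  obtain ⟨D', hD', hright⟩ := exists_jetBound_of_solvesODE ha2 (show (0 : ℝ) < 1 by norm_num) hq2
  set b := |β1| + |β2| with hb
  set e := 1 + |δ1| + |δ2| with he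
  have hb0 : 0 < b := lt_of_le_of_ne (by positivity) hβ.symm
  have he0 : 0 < e := by positivity
  refine ⟨24 * (D ^ 4 * b * (e * D') ^ 2), by positivity, 1, one_pos, ?_⟩
  intro s hs φ11 φ21 χ12 χ22 χ11 χ21 hφ11 iφ11 hφ21 iφ21 hχ12 iχ12 hχ22 iχ22 hχ11 iχ11
    hχ21 iχ21 x hx
  set t := ‖s‖ with ht
  have ht0 : 0 < t := one_pos.trans_le hs
  set E := Real.exp (t / a2) with hE
  have hE0 : 0 < E := Real.exp_pos _
  have jφ11 : JetBound (Icc (-1) 0) φ11 (-1) t (t⁻¹ ^ 3) := by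
    obtain ⟨i0, i1, i2, i3⟩ := iφ11
    refine jetBound_of_forall ?_ ?_ ?_ ?_
    · rw [i0, norm_zero]; positivity
    · rw [i1, norm_zero]; positivity
    · rw [i2, norm_zero]; positivity
    · rw [i3, ← mul_pow, inv_mul_cancel₀ ht0.ne']; simp
  have jφ21 : JetBound (Icc (-1) 0) φ21 (-1) t (b * t⁻¹) := by
    obtain ⟨i0, i1, i2, i3⟩ := iφ21
    refine jetBound_of_forall ?_ ?_ ?_ ?_
    · rw [i0, norm_zero]; positivity
    · rw [i1, Complex.norm_real, mul_assoc, inv_mul_cancel₀ ht0.ne', mul_one, Real.norm_eq_abs]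
      linarith [abs_nonneg β1]
    · rw [i2, norm_neg, Complex.norm_real, Real.norm_eq_abs]
      calc |β1| ≤ b * 1 := by linarith [abs_nonneg β2]
        _ ≤ b * t := by gcongr
        _ = b * t⁻¹ * t ^ 2 := by field_simp
    · rw [i3, norm_zero]; positivity
  have jχ12 : JetBound (Icc 0 1) χ12 1 t t := by
    obtain ⟨i0, i1, i2, i3⟩ := iχ12
    refine jetBound_of_forall ?_ ?_ ?_ ?_
    · rw [i0, norm_neg, norm_one]; exact hs
    · rw [i1, norm_zero]; positivity
    · rw [i2, norm_zero]; positivity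
    · rw [i3, norm_pow, ← ht]; exact le_of_eq (by ring)
  have jχ22 : JetBound (Icc 0 1) χ22 1 t (t ^ 2) := by
    obtain ⟨i0, i1, i2, i3⟩ := iχ22
    refine jetBound_of_forall ?_ ?_ ?_ ?_
    · rw [i0, norm_zero]; positivity
    · rw [i1, norm_neg, norm_one, ← pow_succ]; exact one_le_pow₀ hs
    · rw [i2, norm_pow, ← ht]; exact le_of_eq (by ring)
    · rw [i3, norm_zero]; positivity
  have h01 : (0 : ℝ) ∈ Icc (0 : ℝ) 1 := by simp
  have kχ12 := (hright s hs χ12 hχ12 _ ht0.le 0 h01).2 jχ12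
  have kχ22 := (hright s hs χ22 hχ22 _ (by positivity) 0 h01).2 jχ22
  rw [sub_zero, mul_one] at kχ12 kχ22
  have jχ11 := kχ12.transmission hs (by positivity) iχ11
  have jχ21 := kχ22.transmission hs (by positivity) iχ21
  have kφ11 := (hleft s hs φ11 hφ11 _ (by positivity) x hx).1 jφ11
  have kφ21 := (hleft s hs φ21 hφ21 _ (by positivity) x hx).1 jφ21
  have kχ11 := (hleft s hs χ11 hχ11 _ (by positivity) x hx).2 jχ11
  have kχ21 := (hleft s hs χ21 hχ21 _ (by positivity) x hx).2 jχ21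
  rw [← ht, ← hE, ← he] at kχ11 kχ21
  rw [← ht] at kφ11 kφ21
  set F := Real.exp (t / a1 * (x - -1)) with hF
  set G := Real.exp (t / a1 * (0 - x)) with hG
  refine (Matrix.norm_det_le_of_norm_entry_le _ (fun i : Fin 4 => t ^ (i : ℕ))
    ![D * t⁻¹ ^ 3 * F, D * (b * t⁻¹) * F, D * (e * (D' * t * E) * t ^ 3) * G,
      D * (e * (D' * t ^ 2 * E) * t ^ 3) * G] ?_).trans (le_of_eq ?_)
  · intro i j
    rw [mul_comm]
    fin_cases j
    · exact kφ11 i i.2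
    · exact kφ21 i i.2
    · exact kχ11 i i.2
    · exact kχ21 i i.2
  · have hexp : Real.exp (2 * t * (a1 + a2) / (a1 * a2)) = (F * G * E) ^ 2 := by
      rw [hF, hG, hE, ← Real.exp_add, ← Real.exp_add, ← Real.exp_nat_mul]
      congr 1
      push_cast
      field_simp
      ring
    rw [hexp]
    simp only [Fin.prod_univ_four, Fintype.card_fin, Nat.factorial]
    simp
    field_simp
end
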